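/- arXiv:2103.09025 — 3 statements merged into one kernel-verified Lean document; each statement's English description precedes it below -/
import Mathlib

section
/- Let m be a probability measure on ℝ with finite moments of all orders, and let M_k(τ) denote the moments of the Rayleigh measure τ associated with m by the Markov–Krein correspondence. Then for every k ≥ 1, M_k(τ) = Σ_{ρ ∈ NC(k)} (k + 1 − |ρ|) · fc_ρ(m), where the sum runs over all non-crossing partitions ρ of {1,…,k}, |ρ| is the number of blocks of ρ, and fc_ρ(m) = Π_{B ∈ ρ} fc_{|B|}(m) is the corresponding product of free cumulants of m. -/
open MeasureTheory Finset
open scoped Classical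

/-- `ρ` is a partition of the finite set `S ⊆ ℕ`: its blocks are nonempty subsets of `S`
and every element of `S` lies in exactly one block. -/
def IsPartitionOn (S : Finset ℕ) (ρ : Finset (Finset ℕ)) : Prop :=
  (∀ B ∈ ρ, B.Nonempty) ∧ (∀ B ∈ ρ, B ⊆ S) ∧ (∀ x ∈ S, ∃! B, B ∈ ρ ∧ x ∈ B)

/-- A family of blocks is non-crossing if no two distinct blocks cross. -/
def IsNoncrossing (ρ : Finset (Finset ℕ)) : Prop :=
  ∀ B ∈ ρ, ∀ C ∈ ρ, B ≠ C →
    ¬ ∃ a b c d : ℕ, a ∈ B ∧ b ∈ B ∧ c ∈ C ∧ d ∈ C ∧ a < c ∧ c < b ∧ b < d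

/-- `ρ` is a non-crossing partition of `S`. -/
def IsNCPartitionOn (S : Finset ℕ) (ρ : Finset (Finset ℕ)) : Prop :=
  IsPartitionOn S ρ ∧ IsNoncrossing ρ

/-- `NC(k)`: the finite set of all non-crossing partitions of `{1, …, k}`. -/
noncomputable def NCFinset (k : ℕ) : Finset (Finset (Finset ℕ)) :=
  ((Finset.Icc 1 k).powerset.powerset).filter (IsNCPartitionOn (Finset.Icc 1 k))

/-- The union of the blocks of `ρ` containing `x`; for a partition this is the block of `x`,
or `∅` when `x` is not covered. -/
def blockOf (ρ : Finset (Finset ℕ)) (x : ℕ) : Finset ℕ :=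
  (ρ.filter (fun B => x ∈ B)).biUnion id

lemma mem_blockOf {ρ : Finset (Finset ℕ)} {x y : ℕ} :
    y ∈ blockOf ρ x ↔ ∃ B ∈ ρ, x ∈ B ∧ y ∈ B := by
  simp [blockOf, and_assoc]

lemma isNCPartitionOn_iff {S : Finset ℕ} {ρ : Finset (Finset ℕ)} :
    IsNCPartitionOn S ρ ↔
      ∅ ∉ ρ ∧ (∀ B ∈ ρ, ∀ x ∈ B, x ∈ S) ∧ (∀ x ∈ S, ∃ B ∈ ρ, x ∈ B) ∧
      (∀ B ∈ ρ, ∀ C ∈ ρ, ∀ x ∈ B, x ∈ C → B = C) ∧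
      (∀ B ∈ ρ, ∀ C ∈ ρ, B ≠ C → ∀ a ∈ B, ∀ b ∈ B, ∀ c ∈ C, ∀ d ∈ C,
        a < c → c < b → b < d → False) := by
  constructor
  · rintro ⟨⟨h1, h2, h3⟩, h4⟩
    refine ⟨fun h => by simpa using h1 _ h, fun B hB x hx => h2 B hB hx,
      fun x hx => ?_, fun B hB C hC x hxB hxC => ?_, fun B hB C hC hne a ha b hb c hc d hd h h' h'' =>
        h4 B hB C hC hne ⟨a, b, c, d, ha, hb, hc, hd, h, h', h''⟩⟩
    · obtain ⟨B, hB, -⟩ := h3 x hx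
      exact ⟨B, hB⟩
    · exact (h3 x (h2 B hB hxB)).unique ⟨hB, hxB⟩ ⟨hC, hxC⟩
  · rintro ⟨h1, h2, h3, h4, h5⟩
    refine ⟨⟨fun B hB => ?_, fun B hB x hx => h2 B hB x hx, fun x hx => ?_⟩, ?_⟩
    · rw [Finset.nonempty_iff_ne_empty]
      rintro rfl
      exact h1 hB
    · obtain ⟨B, hB, hx⟩ := h3 x hx
      exact ⟨B, ⟨hB, hx⟩, fun C hC => h4 C hC.1 B hB x hC.2 hx⟩
    · rintro B hB C hC hne ⟨a, b, c, d, ha, hb, hc, hd, h, h', h''⟩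
      exact h5 B hB C hC hne a ha b hb c hc d hd h h' h''

lemma IsNCPartitionOn.blockOf_eq {S : Finset ℕ} {ρ : Finset (Finset ℕ)}
    (h : IsNCPartitionOn S ρ) {B : Finset ℕ} (hB : B ∈ ρ) {x : ℕ} (hx : x ∈ B) :
    blockOf ρ x = B := by
  obtain ⟨-, -, -, h4, -⟩ := isNCPartitionOn_iff.1 h
  ext y
  rw [mem_blockOf]
  constructor
  · rintro ⟨C, hC, hxC, hyC⟩
    rwa [h4 B hB C hC x hx hxC]
  · exact fun hy => ⟨B, hB, hx, hy⟩

lemma IsNCPartitionOn.blockOf_mem {S : Finset ℕ} {ρ : Finset (Finset ℕ)}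
    (h : IsNCPartitionOn S ρ) {x : ℕ} (hx : x ∈ S) :
    blockOf ρ x ∈ ρ ∧ x ∈ blockOf ρ x := by
  obtain ⟨-, -, h3, -, -⟩ := isNCPartitionOn_iff.1 h
  obtain ⟨B, hB, hxB⟩ := h3 x hx
  rw [h.blockOf_eq hB hxB]
  exact ⟨hB, hxB⟩

lemma IsNCPartitionOn.blockOf_eq_empty {S : Finset ℕ} {ρ : Finset (Finset ℕ)}
    (h : IsNCPartitionOn S ρ) {x : ℕ} (hx : x ∉ S) : blockOf ρ x = ∅ := by
  obtain ⟨-, h2, -, -, -⟩ := isNCPartitionOn_iff.1 h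
  ext y
  simp only [mem_blockOf, Finset.notMem_empty, iff_false]
  rintro ⟨B, hB, hxB, -⟩
  exact hx (h2 B hB x hxB)

/-- The finite set of non-crossing partitions of `S`. -/
noncomputable def ncPartitions (S : Finset ℕ) : Finset (Finset (Finset ℕ)) :=
  S.powerset.powerset.filter (IsNCPartitionOn S)

lemma mem_ncPartitions {S : Finset ℕ} {ρ : Finset (Finset ℕ)} :
    ρ ∈ ncPartitions S ↔ IsNCPartitionOn S ρ := by
  simp only [ncPartitions, Finset.mem_filter, Finset.mem_powerset, and_iff_right_iff_imp]
  exact fun h B hB => Finset.mem_powerset.2 (h.1.2.1 B hB)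

lemma NCFinset_eq (k : ℕ) : NCFinset k = ncPartitions (Finset.Icc 1 k) := rfl

lemma ncPartitions_empty : ncPartitions ∅ = {∅} := by
  ext ρ
  rw [mem_ncPartitions, isNCPartitionOn_iff, Finset.mem_singleton]
  constructor
  · rintro ⟨h1, h2, -⟩
    refine Finset.eq_empty_of_forall_notMem fun B hB => ?_
    have : B = ∅ := Finset.eq_empty_of_forall_notMem fun x hx => by simpa using h2 B hB x hx
    exact h1 (this ▸ hB)
  · rintro rfl
    simp

lemma isNCPartitionOn_map_iff {S : Finset ℕ} {ρ : Finset (Finset ℕ)} {f : ℕ ↪ ℕ}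
    (hf : StrictMono f) :
    IsNCPartitionOn (S.map f) (ρ.map (Finset.mapEmbedding f).toEmbedding) ↔
      IsNCPartitionOn S ρ := by
  rw [isNCPartitionOn_iff, isNCPartitionOn_iff]
  simp only [Finset.mem_map, RelEmbedding.coe_toEmbedding, Finset.mapEmbedding_apply,
    Finset.map_eq_empty, forall_exists_index, and_imp, forall_apply_eq_imp_iff₂,
    exists_eq_right, exists_exists_and_eq_and, EmbeddingLike.apply_eq_iff_eq, Finset.map_inj,
    ne_eq, hf.lt_iff_lt]
  constructor
  · rintro ⟨h1, h2, h3, h4, h5⟩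
    exact ⟨h1, h2, h3, fun B hB C hC x hx hx' => h4 B hB C hC x hx x hx' rfl, h5⟩
  · rintro ⟨h1, h2, h3, h4, h5⟩
    refine ⟨h1, h2, h3, ?_, h5⟩
    rintro B hB C hC x hx _ hx' rfl
    exact h4 B hB C hC _ hx hx'

lemma ncPartitions_map (S : Finset ℕ) {f : ℕ ↪ ℕ} (hf : StrictMono f) :
    ncPartitions (S.map f) = (ncPartitions S).map
      (Finset.mapEmbedding (Finset.mapEmbedding f).toEmbedding).toEmbedding := by
  ext ρ
  rw [Finset.mem_map]
  simp only [RelEmbedding.coe_toEmbedding, Finset.mapEmbedding_apply]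
  constructor
  · intro h
    rw [mem_ncPartitions] at h
    have hρ : ∃ σ : Finset (Finset ℕ), σ.map (Finset.mapEmbedding f).toEmbedding = ρ := by
      refine ⟨ρ.image fun B => B.preimage f f.injective.injOn, ?_⟩
      have key : ∀ B ∈ ρ, (B.preimage f f.injective.injOn).map f = B := by
        intro B hB
        ext x
        simp only [Finset.mem_map, Finset.mem_preimage]
        constructor
        · rintro ⟨y, hy, rfl⟩
          exact hy
        · intro hx
          obtain ⟨y, -, rfl⟩ := Finset.mem_map.1 (h.1.2.1 B hB hx)
          exact ⟨y, hx, rfl⟩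
      rw [Finset.map_eq_image, Finset.image_image]
      conv_rhs => rw [← Finset.image_id (s := ρ)]
      exact Finset.image_congr fun B hB => key B hB
    obtain ⟨σ, rfl⟩ := hρ
    exact ⟨σ, mem_ncPartitions.2 ((isNCPartitionOn_map_iff hf).1 h), rfl⟩
  · rintro ⟨σ, hσ, rfl⟩
    exact mem_ncPartitions.2 ((isNCPartitionOn_map_iff hf).2 (mem_ncPartitions.1 hσ))

lemma sum_ncPartitions_Icc {R : Type*} [CommRing R] (c : ℕ → R) {p k : ℕ} (h : p ≤ k) :
    ∑ ρ ∈ ncPartitions (Finset.Icc (p + 1) k), ∏ B ∈ ρ, c B.card =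
      ∑ ρ ∈ NCFinset (k - p), ∏ B ∈ ρ, c B.card := by
  have : Finset.Icc (p + 1) k = (Finset.Icc 1 (k - p)).map (addRightEmbedding p) := by
    rw [Finset.map_add_right_Icc]
    congr 1 <;> omega
  rw [this, ncPartitions_map _ (fun a b hab => by simpa using hab), Finset.sum_map, NCFinset_eq]
  simp

/-- Adjoin the point `n` to the block of `p` in `σ`, and add the blocks of `π`. -/
def glue (n p : ℕ) (σ π : Finset (Finset ℕ)) : Finset (Finset ℕ) :=
  insert (insert n (blockOf σ p)) (σ.erase (blockOf σ p) ∪ π)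

/-- The predecessor of `n` in its block, or `0`. -/
def prevOf (n : ℕ) (ρ : Finset (Finset ℕ)) : ℕ := ((blockOf ρ n).erase n).sup id

/-- The part of `ρ` up to the predecessor of `n`. -/
def lowerPart (n : ℕ) (ρ : Finset (Finset ℕ)) : Finset (Finset ℕ) :=
  (insert ((blockOf ρ n).erase n) (ρ.filter (fun B => B ⊆ Finset.Icc 1 (prevOf n ρ)))).erase ∅

/-- The part of `ρ` strictly between the predecessor of `k + 1` and `k + 1`. -/
def upperPart (k : ℕ) (ρ : Finset (Finset ℕ)) : Finset (Finset ℕ) :=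
  ρ.filter (fun B => B ⊆ Finset.Icc (prevOf (k + 1) ρ + 1) k)

lemma blockOf_cases {p : ℕ} {σ : Finset (Finset ℕ)} (h : IsNCPartitionOn (Finset.Icc 1 p) σ) :
    (p = 0 ∧ blockOf σ p = ∅) ∨ (0 < p ∧ blockOf σ p ∈ σ ∧ p ∈ blockOf σ p) := by
  rcases Nat.eq_zero_or_pos p with hp | hp
  · exact Or.inl ⟨hp, h.blockOf_eq_empty (by simp [hp])⟩
  · exact Or.inr ⟨hp, h.blockOf_mem (by simp; omega)⟩

lemma isNCPartitionOn_glue {p k : ℕ} (hpk : p ≤ k) {σ π : Finset (Finset ℕ)}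
    (hσ : IsNCPartitionOn (Finset.Icc 1 p) σ) (hπ : IsNCPartitionOn (Finset.Icc (p + 1) k) π) :
    IsNCPartitionOn (Finset.Icc 1 (k + 1)) (glue (k + 1) p σ π) := by
  have hb := blockOf_cases hσ
  unfold glue
  generalize blockOf σ p = b at hb ⊢
  rw [isNCPartitionOn_iff] at hσ hπ ⊢
  obtain ⟨s1, s2, s3, s4, s5⟩ := hσ
  obtain ⟨t1, t2, t3, t4, t5⟩ := hπ
  simp only [Finset.mem_Icc] at s2 s3 t2 t3
  have hbp : ∀ x ∈ b, 1 ≤ x ∧ x ≤ p := by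
    rcases hb with ⟨-, rfl⟩ | ⟨-, h, -⟩
    · simp
    · exact s2 b h
  have hmem : ∀ B, B ∈ insert (insert (k + 1) b) (σ.erase b ∪ π) ↔
      B = insert (k + 1) b ∨ (B ≠ b ∧ B ∈ σ) ∨ B ∈ π := by
    intro B; simp
  have hN : ∀ x ∈ insert (k + 1) b, x = k + 1 ∨ (x ∈ b ∧ 1 ≤ x ∧ x ≤ p) := by
    intro x hx
    rcases Finset.mem_insert.1 hx with h | h
    · exact Or.inl h
    · exact Or.inr ⟨h, hbp x h⟩
  have hbσ : ∀ x ∈ b, b ∈ σ := by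
    rcases hb with ⟨-, rfl⟩ | ⟨-, h, -⟩
    · simp
    · exact fun _ _ => h
  simp only [hmem]
  refine ⟨?_, ?_, ?_, ?_, ?_⟩
  · rintro (h | h | h)
    · exact Finset.insert_ne_empty _ _ h.symm
    · exact s1 h.2
    · exact t1 h
  · rintro B (rfl | h | h) x hx <;> rw [Finset.mem_Icc]
    · have := hN x hx
      omega
    · have := s2 B h.2 x hx
      omega
    · have := t2 B h x hx
      omega
  · intro x hx
    rw [Finset.mem_Icc] at hx
    rcases Nat.lt_or_ge k x with h | h
    · exact ⟨_, Or.inl rfl, Finset.mem_insert.2 (Or.inl (by omega))⟩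
    · rcases Nat.lt_or_ge p x with h' | h'
      · obtain ⟨B, hB, hx⟩ := t3 x ⟨h', h⟩
        exact ⟨B, Or.inr (Or.inr hB), hx⟩
      · obtain ⟨B, hB, hx⟩ := s3 x ⟨hx.1, h'⟩
        by_cases hBb : B = b
        · exact ⟨_, Or.inl rfl, Finset.mem_insert_of_mem (hBb ▸ hx)⟩
        · exact ⟨B, Or.inr (Or.inl ⟨hBb, hB⟩), hx⟩
  · have hNσ : ∀ C, C ≠ b → C ∈ σ → ∀ x ∈ insert (k + 1) b, x ∉ C := by
      intro C hCb hC x hx hxC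
      have := s2 C hC x hxC
      rcases hN x hx with h | h
      · omega
      · exact hCb (s4 C hC b (hbσ x h.1) x hxC h.1)
    have hNπ : ∀ C ∈ π, ∀ x ∈ insert (k + 1) b, x ∉ C := by
      intro C hC x hx hxC
      have := t2 C hC x hxC
      have := hN x hx
      omega
    have hσπ : ∀ B ∈ σ, ∀ C ∈ π, ∀ x ∈ B, x ∉ C := by
      intro B hB C hC x hx hxC
      have := s2 B hB x hx
      have := t2 C hC x hxC
      omega
    rintro B (rfl | hB | hB) C (rfl | hC | hC) x hxB hxC
    · rfl
    · exact absurd hxC (hNσ C hC.1 hC.2 x hxB)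
    · exact absurd hxC (hNπ C hC x hxB)
    · exact absurd hxB (hNσ B hB.1 hB.2 x hxC)
    · exact s4 B hB.2 C hC.2 x hxB hxC
    · exact absurd hxC (hσπ B hB.2 C hC x hxB)
    · exact absurd hxB (hNπ B hB x hxC)
    · exact absurd hxB (hσπ C hC.2 B hB x hxC)
    · exact t4 B hB C hC x hxB hxC
  · rintro B (rfl | hB | hB) C (rfl | hC | hC) hne u hu v hv w hw z hz h1 h2 h3
    · exact hne rfl
    · have := s2 C hC.2 z hz
      have hub := (hN u hu).resolve_left (by omega)
      have hvb := (hN v hv).resolve_left (by omega)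
      exact s5 b (hbσ u hub.1) C hC.2 (Ne.symm hC.1) u hub.1 v hvb.1 w hw z hz h1 h2 h3
    · have := t2 C hC w hw
      have := t2 C hC z hz
      have := hN v hv
      omega
    · have hvs := s2 B hB.2 v hv
      rcases hb with ⟨hp, -⟩ | ⟨hp, hb, hpb⟩
      · omega
      · have hvp : v ≠ p := by
          rintro rfl
          exact hB.1 (s4 B hB.2 b hb v hv hpb)
        have hwb := (hN w hw).resolve_left (by omega)
        exact s5 B hB.2 b hb hB.1 u hu v hv w hwb.1 p hpb h1 h2 (by omega)
    · exact s5 B hB.2 C hC.2 hne u hu v hv w hw z hz h1 h2 h3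
    · have := s2 B hB.2 v hv
      have := t2 C hC w hw
      omega
    · have := t2 B hB u hu
      have := t2 B hB v hv
      have := hN w hw
      omega
    · have := t2 B hB u hu
      have := s2 C hC.2 w hw
      omega
    · exact t5 B hB C hC hne u hu v hv w hw z hz h1 h2 h3

lemma blockOf_glue {p k : ℕ} (hpk : p ≤ k) {σ π : Finset (Finset ℕ)}
    (hσ : IsNCPartitionOn (Finset.Icc 1 p) σ) (hπ : IsNCPartitionOn (Finset.Icc (p + 1) k) π) :
    blockOf (glue (k + 1) p σ π) (k + 1) = insert (k + 1) (blockOf σ p) :=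
  (isNCPartitionOn_glue hpk hσ hπ).blockOf_eq (Finset.mem_insert_self _ _)
    (Finset.mem_insert_self _ _)

lemma erase_blockOf_glue {p k : ℕ} (hpk : p ≤ k) {σ π : Finset (Finset ℕ)}
    (hσ : IsNCPartitionOn (Finset.Icc 1 p) σ) (hπ : IsNCPartitionOn (Finset.Icc (p + 1) k) π) :
    (blockOf (glue (k + 1) p σ π) (k + 1)).erase (k + 1) = blockOf σ p := by
  rw [blockOf_glue hpk hσ hπ, Finset.erase_insert]
  rw [mem_blockOf]
  rintro ⟨B, hB, -, h⟩
  have := Finset.mem_Icc.1 (hσ.1.2.1 B hB h)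
  omega

lemma prevOf_glue {p k : ℕ} (hpk : p ≤ k) {σ π : Finset (Finset ℕ)}
    (hσ : IsNCPartitionOn (Finset.Icc 1 p) σ) (hπ : IsNCPartitionOn (Finset.Icc (p + 1) k) π) :
    prevOf (k + 1) (glue (k + 1) p σ π) = p := by
  rw [prevOf, erase_blockOf_glue hpk hσ hπ]
  rcases blockOf_cases hσ with ⟨rfl, h⟩ | ⟨hp, h, h'⟩
  · simp [h]
  · refine le_antisymm (Finset.sup_le fun x hx => ?_) (Finset.le_sup (f := id) h')
    exact (Finset.mem_Icc.1 (hσ.1.2.1 _ h hx)).2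

lemma lowerPart_glue {p k : ℕ} (hpk : p ≤ k) {σ π : Finset (Finset ℕ)}
    (hσ : IsNCPartitionOn (Finset.Icc 1 p) σ) (hπ : IsNCPartitionOn (Finset.Icc (p + 1) k) π) :
    lowerPart (k + 1) (glue (k + 1) p σ π) = σ := by
  rw [lowerPart, erase_blockOf_glue hpk hσ hπ, prevOf_glue hpk hσ hπ, glue]
  have hb := blockOf_cases hσ
  generalize blockOf σ p = b at hb ⊢
  rw [isNCPartitionOn_iff] at hσ hπ
  obtain ⟨s1, s2, s3, s4, s5⟩ := hσ
  obtain ⟨t1, t2, t3, t4, t5⟩ := hπ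
  ext B
  simp only [Finset.mem_erase, Finset.mem_insert, Finset.mem_filter, Finset.mem_union]
  constructor
  · rintro ⟨hne, rfl | ⟨rfl | h | h, hs⟩⟩
    · rcases hb with hb | hb
      · exact absurd hb.2 hne
      · exact hb.2.1
    · have := Finset.mem_Icc.1 (hs (Finset.mem_insert_self _ _))
      omega
    · exact h.2
    · obtain ⟨x, hx⟩ := Finset.nonempty_iff_ne_empty.2 hne
      have := Finset.mem_Icc.1 (hs hx)
      have := Finset.mem_Icc.1 (t2 B h x hx)
      omega
  · intro h
    refine ⟨fun h0 => s1 (h0 ▸ h), ?_⟩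
    by_cases hB : B = b
    · exact Or.inl hB
    · exact Or.inr ⟨Or.inr (Or.inl ⟨hB, h⟩), fun x hx => s2 B h x hx⟩

lemma upperPart_glue {p k : ℕ} (hpk : p ≤ k) {σ π : Finset (Finset ℕ)}
    (hσ : IsNCPartitionOn (Finset.Icc 1 p) σ) (hπ : IsNCPartitionOn (Finset.Icc (p + 1) k) π) :
    upperPart k (glue (k + 1) p σ π) = π := by
  rw [upperPart, prevOf_glue hpk hσ hπ, glue]
  generalize blockOf σ p = b
  rw [isNCPartitionOn_iff] at hσ hπ
  obtain ⟨s1, s2, s3, s4, s5⟩ := hσ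
  obtain ⟨t1, t2, t3, t4, t5⟩ := hπ
  ext B
  simp only [Finset.mem_erase, Finset.mem_insert, Finset.mem_filter, Finset.mem_union]
  constructor
  · rintro ⟨rfl | h | h, hs⟩
    · have := Finset.mem_Icc.1 (hs (Finset.mem_insert_self _ _))
      omega
    · have hne : B.Nonempty := Finset.nonempty_iff_ne_empty.2 fun h0 => s1 (h0 ▸ h.2)
      obtain ⟨x, hx⟩ := hne
      have := Finset.mem_Icc.1 (hs hx)
      have := Finset.mem_Icc.1 (s2 B h.2 x hx)
      omega
    · exact h
  · exact fun h => ⟨Or.inr (Or.inr h), fun x hx => t2 B h x hx⟩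

lemma prevOf_le {k : ℕ} {ρ : Finset (Finset ℕ)} (h : IsNCPartitionOn (Finset.Icc 1 (k + 1)) ρ) :
    prevOf (k + 1) ρ ≤ k := by
  refine Finset.sup_le fun x hx => ?_
  rw [Finset.mem_erase] at hx
  have := Finset.mem_Icc.1 (h.1.2.1 _ (h.blockOf_mem (by simp)).1 hx.2)
  simp only [id]
  omega

lemma prevOf_cases {k : ℕ} {ρ : Finset (Finset ℕ)}
    (h : IsNCPartitionOn (Finset.Icc 1 (k + 1)) ρ) :
    (prevOf (k + 1) ρ = 0 ∧ (blockOf ρ (k + 1)).erase (k + 1) = ∅) ∨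
      (0 < prevOf (k + 1) ρ ∧ prevOf (k + 1) ρ ∈ (blockOf ρ (k + 1)).erase (k + 1)) := by
  unfold prevOf
  have h0 : ∀ x ∈ (blockOf ρ (k + 1)).erase (k + 1), 0 < x := fun x hx =>
    (Finset.mem_Icc.1 (h.1.2.1 _ (h.blockOf_mem (by simp)).1 (Finset.mem_of_mem_erase hx))).1
  generalize (blockOf ρ (k + 1)).erase (k + 1) = b at h0 ⊢
  rcases b.eq_empty_or_nonempty with rfl | hne
  · simp
  · obtain ⟨x, hx, hx'⟩ := Finset.exists_mem_eq_sup b hne id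
    rw [hx']
    exact Or.inr ⟨h0 x hx, hx⟩

lemma subset_Icc_or_subset_Icc {k : ℕ} {ρ : Finset (Finset ℕ)}
    (h : IsNCPartitionOn (Finset.Icc 1 (k + 1)) ρ) {B : Finset ℕ} (hB : B ∈ ρ)
    (hne : B ≠ blockOf ρ (k + 1)) :
    B ⊆ Finset.Icc 1 (prevOf (k + 1) ρ) ∨ B ⊆ Finset.Icc (prevOf (k + 1) ρ + 1) k := by
  have hp := prevOf_cases h
  obtain ⟨hb, hb'⟩ := h.blockOf_mem (x := k + 1) (by simp)
  generalize prevOf (k + 1) ρ = p at hp ⊢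
  generalize blockOf ρ (k + 1) = b at *
  obtain ⟨s1, s2, s3, s4, s5⟩ := isNCPartitionOn_iff.1 h
  simp only [Finset.mem_Icc] at s2
  have hk : ∀ x ∈ B, x ≤ k := by
    intro x hx
    have h1 := s2 B hB x hx
    have : x ≠ k + 1 := by
      rintro rfl
      exact hne (s4 B hB b hb _ hx hb')
    omega
  rcases hp with ⟨rfl, -⟩ | ⟨-, hpb⟩
  · right
    intro x hx
    have := s2 B hB x hx
    have := hk x hx
    simp; omega
  · rw [Finset.mem_erase] at hpb
    by_contra! hcon
    obtain ⟨h1, h2⟩ := hcon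
    rw [Finset.not_subset] at h1 h2
    obtain ⟨y, hy, hy'⟩ := h1
    obtain ⟨x, hx, hx'⟩ := h2
    have hxp : x ≠ p := by
      rintro rfl
      exact hne (s4 B hB b hb _ hx hpb.2)
    have := s2 B hB x hx
    have := s2 B hB y hy
    have := hk x hx
    have := hk y hy
    rw [Finset.mem_Icc] at hx' hy'
    exact s5 B hB b hb hne x hx y hy p hpb.2 (k + 1) hb' (by omega) (by omega) (by omega)

lemma isNCPartitionOn_lowerPart {k : ℕ} {ρ : Finset (Finset ℕ)}
    (h : IsNCPartitionOn (Finset.Icc 1 (k + 1)) ρ) :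
    IsNCPartitionOn (Finset.Icc 1 (prevOf (k + 1) ρ)) (lowerPart (k + 1) ρ) := by
  have hp := prevOf_cases h
  have hpk := prevOf_le h
  have hcov := fun B hB hne => subset_Icc_or_subset_Icc h (B := B) hB hne
  obtain ⟨hb, hb'⟩ := h.blockOf_mem (x := k + 1) (by simp)
  have hle : ∀ x ∈ (blockOf ρ (k + 1)).erase (k + 1), x ≤ prevOf (k + 1) ρ :=
    fun x hx => Finset.le_sup (f := id) hx
  unfold lowerPart
  generalize prevOf (k + 1) ρ = p at *
  generalize blockOf ρ (k + 1) = b at *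
  rw [isNCPartitionOn_iff] at h ⊢
  obtain ⟨s1, s2, s3, s4, s5⟩ := h
  simp only [Finset.mem_Icc, Finset.mem_erase] at s2 s3 hle hp
  have hmem : ∀ B, B ∈ (insert (b.erase (k + 1))
      (ρ.filter (fun B => B ⊆ Finset.Icc 1 p))).erase ∅ ↔
      B ≠ ∅ ∧ (B = b.erase (k + 1) ∨ (B ∈ ρ ∧ ∀ x ∈ B, 1 ≤ x ∧ x ≤ p)) := by
    intro B
    simp [Finset.subset_iff]
  have hnb : ∀ B ∈ ρ, (∀ x ∈ B, 1 ≤ x ∧ x ≤ p) → B ≠ b := by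
    rintro B - h rfl
    have := h _ hb'
    omega
  simp only [hmem]
  refine ⟨fun h => h.1 rfl, ?_, ?_, ?_, ?_⟩
  · rintro B ⟨-, rfl | ⟨hB, hBs⟩⟩ x hx
    · rw [Finset.mem_erase] at hx
      exact Finset.mem_Icc.2 ⟨(s2 b hb x hx.2).1, hle x hx⟩
    · exact Finset.mem_Icc.2 (hBs x hx)
  · intro x hx
    rw [Finset.mem_Icc] at hx
    obtain ⟨B, hB, hxB⟩ := s3 x ⟨hx.1, by omega⟩
    by_cases hBb : B = b
    · subst hBb
      have : x ∈ B.erase (k + 1) := Finset.mem_erase.2 ⟨by omega, hxB⟩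
      exact ⟨B.erase (k + 1), ⟨Finset.ne_empty_of_mem this, Or.inl rfl⟩, this⟩
    · refine ⟨B, ⟨Finset.ne_empty_of_mem hxB, Or.inr ⟨hB, ?_⟩⟩, hxB⟩
      rcases hcov B hB hBb with hc | hc
      · exact fun y hy => Finset.mem_Icc.1 (hc hy)
      · have := Finset.mem_Icc.1 (hc hxB)
        omega
  · rintro B ⟨-, rfl | ⟨hB, hBs⟩⟩ C ⟨-, rfl | ⟨hC, hCs⟩⟩ x hxB hxC
    · rfl
    · exact absurd (s4 C hC b hb x hxC (Finset.mem_of_mem_erase hxB)) (hnb C hC hCs)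
    · exact absurd (s4 B hB b hb x hxB (Finset.mem_of_mem_erase hxC)) (hnb B hB hBs)
    · exact s4 B hB C hC x hxB hxC
  · rintro B ⟨-, rfl | ⟨hB, hBs⟩⟩ C ⟨-, rfl | ⟨hC, hCs⟩⟩ hne u hu v hv w hw z hz
    · exact absurd rfl hne
    · exact s5 b hb C hC (hnb C hC hCs).symm u (Finset.mem_of_mem_erase hu) v
        (Finset.mem_of_mem_erase hv) w hw z hz
    · exact s5 B hB b hb (hnb B hB hBs) u hu v hv w (Finset.mem_of_mem_erase hw) z
        (Finset.mem_of_mem_erase hz)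
    · exact s5 B hB C hC hne u hu v hv w hw z hz

lemma isNCPartitionOn_upperPart {k : ℕ} {ρ : Finset (Finset ℕ)}
    (h : IsNCPartitionOn (Finset.Icc 1 (k + 1)) ρ) :
    IsNCPartitionOn (Finset.Icc (prevOf (k + 1) ρ + 1) k) (upperPart k ρ) := by
  have hcov := fun B hB hne => subset_Icc_or_subset_Icc h (B := B) hB hne
  obtain ⟨hb, hb'⟩ := h.blockOf_mem (x := k + 1) (by simp)
  have hle : ∀ x ∈ (blockOf ρ (k + 1)).erase (k + 1), x ≤ prevOf (k + 1) ρ :=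
    fun x hx => Finset.le_sup (f := id) hx
  unfold upperPart
  generalize prevOf (k + 1) ρ = p at *
  generalize blockOf ρ (k + 1) = b at *
  rw [isNCPartitionOn_iff] at h ⊢
  obtain ⟨s1, s2, s3, s4, s5⟩ := h
  simp only [Finset.mem_filter]
  refine ⟨fun h => s1 h.1, fun B hB x hx => hB.2 hx, fun x hx => ?_,
    fun B hB C hC => s4 B hB.1 C hC.1, fun B hB C hC => s5 B hB.1 C hC.1⟩
  rw [Finset.mem_Icc] at hx
  obtain ⟨B, hB, hxB⟩ := s3 x (Finset.mem_Icc.2 ⟨by omega, by omega⟩)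
  have hBb : B ≠ b := by
    rintro rfl
    have := hle x (Finset.mem_erase.2 ⟨by omega, hxB⟩)
    omega
  refine ⟨B, ⟨hB, ?_⟩, hxB⟩
  rcases hcov B hB hBb with hc | hc
  · have := Finset.mem_Icc.1 (hc hxB)
    omega
  · exact hc

lemma glue_lowerPart_upperPart {k : ℕ} {ρ : Finset (Finset ℕ)}
    (h : IsNCPartitionOn (Finset.Icc 1 (k + 1)) ρ) :
    glue (k + 1) (prevOf (k + 1) ρ) (lowerPart (k + 1) ρ) (upperPart k ρ) = ρ := by
  have hp := prevOf_cases h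
  have hl := isNCPartitionOn_lowerPart h
  have hcov := fun B hB hne => subset_Icc_or_subset_Icc h (B := B) hB hne
  obtain ⟨hb, hb'⟩ := h.blockOf_mem (x := k + 1) (by simp)
  have hpk := prevOf_le h
  have hblock : blockOf (lowerPart (k + 1) ρ) (prevOf (k + 1) ρ) =
      (blockOf ρ (k + 1)).erase (k + 1) := by
    rcases hp with ⟨h0, h1⟩ | ⟨h0, h1⟩
    · rw [hl.blockOf_eq_empty (by simp [h0]), h1]
    · refine hl.blockOf_eq ?_ h1
      exact Finset.mem_erase.2 ⟨Finset.ne_empty_of_mem h1, Finset.mem_insert_self _ _⟩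
  rw [glue, hblock, Finset.insert_erase hb', lowerPart, upperPart]
  generalize prevOf (k + 1) ρ = p at *
  generalize blockOf ρ (k + 1) = b at *
  obtain ⟨s1, s2, s3, s4, s5⟩ := isNCPartitionOn_iff.1 h
  ext B
  simp only [Finset.mem_erase, Finset.mem_insert, Finset.mem_filter, Finset.mem_union]
  constructor
  · rintro (rfl | ⟨h1, -, rfl | h2⟩ | h1)
    · exact hb
    · exact absurd rfl h1
    · exact h2.1
    · exact h1.1
  · intro hB
    by_cases hBb : B = b
    · exact Or.inl hBb
    · right
      rcases hcov B hB hBb with hc | hc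
      · refine Or.inl ⟨?_, fun h0 => s1 (h0 ▸ hB), Or.inr ⟨hB, hc⟩⟩
        rintro rfl
        obtain ⟨x, hx⟩ : (b.erase (k + 1)).Nonempty :=
          Finset.nonempty_iff_ne_empty.2 fun h0 => s1 (h0 ▸ hB)
        exact hBb (s4 _ hB b hb x hx (Finset.mem_of_mem_erase hx))
      · exact Or.inr ⟨hB, hc⟩

/-- The weight of `ρ` for the sequence `c`, where the block of `k` counts as if it had
`j` additional points. -/
def markedWeight {R : Type*} [CommRing R] (c : ℕ → R) (j k : ℕ) (ρ : Finset (Finset ℕ)) : R :=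
  c ((blockOf ρ k).card + j) * ∏ B ∈ ρ.erase (blockOf ρ k), c B.card

/-- The sum of the marked weights over `NC(k)`. -/
noncomputable def markedSum {R : Type*} [CommRing R] (c : ℕ → R) (j k : ℕ) : R :=
  ∑ ρ ∈ NCFinset k, markedWeight c j k ρ

lemma markedSum_zero_right {R : Type*} [CommRing R] (c : ℕ → R) (j : ℕ) :
    markedSum c j 0 = c j := by
  have : NCFinset 0 = {∅} := ncPartitions_empty
  simp [markedSum, this, markedWeight, blockOf]

lemma markedSum_zero_left {R : Type*} [CommRing R] (c : ℕ → R) (hc : c 0 = 1) (k : ℕ) :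
    markedSum c 0 k = ∑ ρ ∈ NCFinset k, ∏ B ∈ ρ, c B.card := by
  refine Finset.sum_congr rfl fun ρ hρ => ?_
  have hρ := mem_ncPartitions.1 hρ
  rw [markedWeight, add_zero]
  rcases blockOf_cases hρ with ⟨rfl, h⟩ | ⟨-, h, -⟩
  · rw [h, Finset.card_empty, hc, one_mul, Finset.erase_eq_of_notMem]
    exact (isNCPartitionOn_iff.1 hρ).1
  · exact Finset.mul_prod_erase ρ (fun B => c B.card) h

lemma markedWeight_glue {R : Type*} [CommRing R] (c : ℕ → R) (j : ℕ) {p k : ℕ} (hpk : p ≤ k)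
    {σ π : Finset (Finset ℕ)}
    (hσ : IsNCPartitionOn (Finset.Icc 1 p) σ) (hπ : IsNCPartitionOn (Finset.Icc (p + 1) k) π) :
    markedWeight c j (k + 1) (glue (k + 1) p σ π) =
      markedWeight c (j + 1) p σ * ∏ B ∈ π, c B.card := by
  have hle : ∀ B ∈ σ, ∀ x ∈ B, x ≤ p := fun B hB x hx =>
    (Finset.mem_Icc.1 (hσ.1.2.1 B hB hx)).2
  have hge : ∀ B ∈ π, ∀ x ∈ B, p + 1 ≤ x ∧ x ≤ k := fun B hB x hx =>
    Finset.mem_Icc.1 (hπ.1.2.1 B hB hx)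
  have hnot : k + 1 ∉ blockOf σ p := by
    rw [mem_blockOf]
    rintro ⟨B, hB, -, h⟩
    have := hle B hB _ h
    omega
  have hdisj : Disjoint (σ.erase (blockOf σ p)) π := by
    rw [Finset.disjoint_left]
    intro B hB hB'
    obtain ⟨x, hx⟩ := hπ.1.1 B hB'
    have := hle B (Finset.mem_of_mem_erase hB) x hx
    have := hge B hB' x hx
    omega
  have hnew : insert (k + 1) (blockOf σ p) ∉ σ.erase (blockOf σ p) ∪ π := by
    intro h
    rcases Finset.mem_union.1 h with h | h
    · have := hle _ (Finset.mem_of_mem_erase h) (k + 1) (Finset.mem_insert_self _ _)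
      omega
    · have := hge _ h (k + 1) (Finset.mem_insert_self _ _)
      omega
  rw [markedWeight, blockOf_glue hpk hσ hπ, glue, Finset.erase_insert hnew,
    Finset.prod_union hdisj, Finset.card_insert_of_notMem hnot, markedWeight, mul_assoc,
    add_assoc, add_comm 1 j]

lemma markedSum_succ {R : Type*} [CommRing R] (c : ℕ → R) (hc : c 0 = 1) (j k : ℕ) :
    markedSum c j (k + 1) =
      ∑ p ∈ Finset.range (k + 1), markedSum c (j + 1) p * markedSum c 0 (k - p) := by
  have hR : ∀ p ∈ Finset.range (k + 1), markedSum c (j + 1) p * markedSum c 0 (k - p) =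
      ∑ x ∈ NCFinset p ×ˢ ncPartitions (Finset.Icc (p + 1) k),
        markedWeight c (j + 1) p x.1 * ∏ B ∈ x.2, c B.card := by
    intro p hp
    rw [Finset.mem_range] at hp
    rw [markedSum_zero_left c hc, ← sum_ncPartitions_Icc c (by omega : p ≤ k), markedSum,
      Finset.sum_mul_sum, Finset.sum_product]
  rw [Finset.sum_congr rfl hR, Finset.sum_sigma', markedSum]
  refine Finset.sum_nbij'
    (fun ρ => (⟨prevOf (k + 1) ρ, lowerPart (k + 1) ρ, upperPart k ρ⟩ :
      (_ : ℕ) × (Finset (Finset ℕ) × Finset (Finset ℕ))))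
    (fun x => glue (k + 1) x.1 x.2.1 x.2.2) ?_ ?_ ?_ ?_ ?_
  · intro ρ hρ
    have hρ := mem_ncPartitions.1 hρ
    simp only [Finset.mem_sigma, Finset.mem_range, Finset.mem_product, NCFinset_eq,
      mem_ncPartitions]
    exact ⟨Nat.lt_succ_of_le (prevOf_le hρ), isNCPartitionOn_lowerPart hρ,
      isNCPartitionOn_upperPart hρ⟩
  · rintro ⟨p, σ, π⟩ hx
    simp only [Finset.mem_sigma, Finset.mem_range, Finset.mem_product, NCFinset_eq,
      mem_ncPartitions] at hx ⊢
    exact isNCPartitionOn_glue (by omega) hx.2.1 hx.2.2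
  · intro ρ hρ
    exact glue_lowerPart_upperPart (mem_ncPartitions.1 hρ)
  · rintro ⟨p, σ, π⟩ hx
    simp only [Finset.mem_sigma, Finset.mem_range, Finset.mem_product, NCFinset_eq,
      mem_ncPartitions] at hx ⊢
    have hpk : p ≤ k := by omega
    rw [prevOf_glue hpk hx.2.1 hx.2.2, lowerPart_glue hpk hx.2.1 hx.2.2,
      upperPart_glue hpk hx.2.1 hx.2.2]
  · intro ρ hρ
    have hρ := mem_ncPartitions.1 hρ
    conv_lhs => rw [← glue_lowerPart_upperPart hρ]
    exact markedWeight_glue c j (prevOf_le hρ) (isNCPartitionOn_lowerPart hρ)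
      (isNCPartitionOn_upperPart hρ)

open PowerSeries in
/-- If `F j = a j + X F₀ F_{j+1}` and `G` is the derivative of `F` in the direction scaling
all `a j` with `j ≥ 1`, then `X F₀' = F₀ (X F₀' + F₀ - 1 - G₀)`. -/
lemma X_mul_derivative_eq (F G : ℕ → PowerSeries ℝ) (a : ℕ → ℝ) (ha : a 0 = 1)
    (hF : ∀ j, F j = C (a j) + X * (F 0 * F (j + 1)))
    (hG : ∀ j, G j = C (if j = 0 then 0 else a j) + X * (G 0 * F (j + 1) + F 0 * G (j + 1))) :
    X * derivative ℝ (F 0) = F 0 * (X * derivative ℝ (F 0) + F 0 - 1 - G 0) := by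
  set y := X * F 0 with hy
  set S : ℕ → PowerSeries ℝ := fun N => ∑ i ∈ Finset.range N, y ^ i * F (i + 1) with hS
  have hD : ∀ N, derivative ℝ (F 0) =
      derivative ℝ y * S N + y ^ N * derivative ℝ (F N) := by
    intro N
    induction N with
    | zero => simp [hS]
    | succ N ih =>
      have h : derivative ℝ (F N) =
          derivative ℝ y * F (N + 1) + y * derivative ℝ (F (N + 1)) := by
        conv_lhs => rw [hF N, ← mul_assoc, ← hy]
        simp [Derivation.leibniz]
        ring
      rw [ih, h]
      simp only [hS, Finset.sum_range_succ]
      ring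
  have hE : ∀ N, G 0 - F 0 + 1 = X * G 0 * S (N + 1) + y ^ (N + 1) * (G (N + 1) - F (N + 1)) := by
    intro N
    induction N with
    | zero =>
      have h1 := hF 0
      have h2 := hG 0
      rw [ha, map_one] at h1
      simp only [if_true, map_zero] at h2
      simp only [hS, hy, zero_add, Finset.sum_range_one] at h1 h2 ⊢
      linear_combination h2 - h1
    | succ N ih =>
      have h1 := hF (N + 1)
      have h2 := hG (N + 1)
      rw [if_neg (Nat.succ_ne_zero N)] at h2
      have h : G (N + 1) - F (N + 1) =
          X * G 0 * F (N + 2) + y * (G (N + 2) - F (N + 2)) := by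
        rw [hy]
        linear_combination h2 - h1
      rw [ih, h]
      simp only [hS, Finset.sum_range_succ _ (N + 1)]
      ring
  have hDy : derivative ℝ y = F 0 + X * derivative ℝ (F 0) := by
    rw [hy]
    simp [Derivation.leibniz]
    ring
  rw [← sub_eq_zero]
  ext n
  rw [map_zero]
  have hdvd : X ^ (n + 1) ∣ (1 - X * S (n + 1)) *
      (X * derivative ℝ (F 0) - F 0 * (X * derivative ℝ (F 0) + F 0 - 1 - G 0)) := by
    have h1 := hD (n + 1)
    have h2 := hE n
    rw [hDy] at h1
    have hyX : y ^ (n + 1) = X ^ (n + 1) * F 0 ^ (n + 1) := by rw [hy, mul_pow]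
    rw [hyX] at h1 h2
    refine ⟨F 0 ^ (n + 1) * ((1 - F 0) * X * derivative ℝ (F (n + 1)) +
      F 0 * (G (n + 1) - F (n + 1))), ?_⟩
    linear_combination (X - F 0 * X) * h1 + F 0 * h2
  have hunit : IsUnit (1 - X * S (n + 1)) := by
    rw [PowerSeries.isUnit_iff_constantCoeff]
    simp
  rw [hunit.dvd_mul_left, PowerSeries.X_pow_dvd_iff] at hdvd
  exact hdvd n (Nat.lt_succ_self n)

/-- The sequence `fc` scaled by an indeterminate, with value `1` at `0`. -/
noncomputable def scaledSeq (fc : ℕ → ℝ) (n : ℕ) : Polynomial ℝ :=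
  if n = 0 then 1 else Polynomial.X * Polynomial.C (fc n)

lemma markedSum_scaledSeq (fc : ℕ → ℝ) (k : ℕ) :
    markedSum (scaledSeq fc) 0 k =
      ∑ ρ ∈ NCFinset k, Polynomial.X ^ ρ.card * Polynomial.C (∏ B ∈ ρ, fc B.card) := by
  rw [markedSum_zero_left _ (by simp [scaledSeq])]
  refine Finset.sum_congr rfl fun ρ hρ => ?_
  have hρ := mem_ncPartitions.1 hρ
  rw [Finset.prod_congr rfl (g := fun B => Polynomial.X * Polynomial.C (fc B.card)),
    Finset.prod_mul_distrib, Finset.prod_const, map_prod]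
  intro B hB
  exact if_neg (Finset.card_ne_zero.2 (hρ.1.1 B hB))

lemma eval_markedSum_scaledSeq (fc : ℕ → ℝ) (k : ℕ) :
    (markedSum (scaledSeq fc) 0 k).eval 1 = ∑ ρ ∈ NCFinset k, ∏ B ∈ ρ, fc B.card := by
  rw [markedSum_scaledSeq, Polynomial.eval_finsetSum]
  simp only [Polynomial.eval_mul, Polynomial.eval_pow, Polynomial.eval_X, Polynomial.eval_C,
    one_pow, one_mul]

lemma eval_derivative_markedSum_scaledSeq (fc : ℕ → ℝ) (k : ℕ) :
    (Polynomial.derivative (markedSum (scaledSeq fc) 0 k)).eval 1 =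
      ∑ ρ ∈ NCFinset k, (ρ.card : ℝ) * ∏ B ∈ ρ, fc B.card := by
  rw [markedSum_scaledSeq, Polynomial.derivative_sum, Polynomial.eval_finsetSum]
  refine Finset.sum_congr rfl fun ρ _ => ?_
  rw [Polynomial.derivative_mul, Polynomial.derivative_C, Polynomial.derivative_X_pow]
  simp only [Polynomial.eval_mul, Polynomial.eval_pow, Polynomial.eval_X, Polynomial.eval_C,
    Polynomial.eval_natCast, one_pow, mul_one,
    mul_zero, add_zero, map_natCast]

/-- The recursion satisfied by the sums of `(k + 1 - |ρ|) fc_ρ`. -/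
lemma mul_sum_NCFinset_eq (fc : ℕ → ℝ) (k : ℕ) :
    (k : ℝ) * ∑ ρ ∈ NCFinset k, ∏ B ∈ ρ, fc B.card =
      ∑ x ∈ HasAntidiagonal.antidiagonal k,
        (∑ ρ ∈ NCFinset x.1, ∏ B ∈ ρ, fc B.card) *
          ((∑ ρ ∈ NCFinset x.2, ((x.2 : ℝ) + 1 - ρ.card) * ∏ B ∈ ρ, fc B.card) -
            if x.2 = 0 then 1 else 0) := by
  set W := fun j k => markedSum (scaledSeq fc) j k with hW
  set F : ℕ → PowerSeries ℝ := fun j => PowerSeries.mk fun k => (W j k).eval 1 with hF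
  set G : ℕ → PowerSeries ℝ := fun j =>
    PowerSeries.mk fun k => (Polynomial.derivative (W j k)).eval 1 with hG
  have hrec : ∀ j k, W j (k + 1) =
      ∑ x ∈ HasAntidiagonal.antidiagonal k, W 0 x.1 * W (j + 1) x.2 := by
    intro j k
    rw [hW]
    simp only
    rw [markedSum_succ _ (by simp [scaledSeq]),
      ← Finset.Nat.sum_antidiagonal_swap, Finset.Nat.sum_antidiagonal_eq_sum_range_succ_mk]
    exact Finset.sum_congr rfl fun p _ => mul_comm _ _
  have hzero : ∀ j, W j 0 = scaledSeq fc j := fun j => markedSum_zero_right _ _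
  have main := X_mul_derivative_eq F G (fun j => (scaledSeq fc j).eval 1)
    (by simp [scaledSeq]) (fun j => by
      ext (_ | n)
      · simp [hF, hzero]
      · rw [map_add, PowerSeries.coeff_succ_X_mul]
        simp [hF, PowerSeries.coeff_mul, hrec,
          Polynomial.eval_finsetSum]) (fun j => by
      ext (_ | n)
      · by_cases hj : j = 0 <;> simp [hG, hzero, scaledSeq, hj]
      · rw [map_add, PowerSeries.coeff_succ_X_mul]
        simp [hF, hG, PowerSeries.coeff_mul, hrec, Polynomial.eval_finsetSum, Finset.sum_add_distrib])
  have hXd : ∀ n, PowerSeries.coeff n (PowerSeries.X * PowerSeries.derivative ℝ (F 0)) =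
      n * (W 0 n).eval 1 := by
    rintro (_ | n)
    · simp
    · simp [PowerSeries.coeff_succ_X_mul, PowerSeries.coeff_derivative, hF, mul_comm]
  have h := congrArg (PowerSeries.coeff k) main
  rw [hXd, PowerSeries.coeff_mul] at h
  rw [← eval_markedSum_scaledSeq]
  refine h.trans (Finset.sum_congr rfl fun x _ => ?_)
  rw [← eval_markedSum_scaledSeq]
  congr 1
  · simp [hF, hW]
  · have e1 : PowerSeries.coeff x.2 (F 0) = ∑ ρ ∈ NCFinset x.2, ∏ B ∈ ρ, fc B.card := by
      rw [← eval_markedSum_scaledSeq]; simp [hF, hW]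
    have e2 : PowerSeries.coeff x.2 (G 0) =
        ∑ ρ ∈ NCFinset x.2, (ρ.card : ℝ) * ∏ B ∈ ρ, fc B.card := by
      rw [← eval_derivative_markedSum_scaledSeq]; simp [hG, hW]
    rw [map_sub, map_sub, map_add, hXd, PowerSeries.coeff_one, e1, e2, hW]
    simp only
    rw [eval_markedSum_scaledSeq]
    simp only [sub_mul, Finset.sum_sub_distrib, ← Finset.mul_sum]
    ring

/-- Let `m` be a probability measure on `ℝ` with finite moments of all
orders, `fc` its free cumulants (characterized by the moment–cumulant formula), and
`Mτ k` the moments of the Rayleigh measure `τ` associated with `m` by the Markov–Krein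
correspondence (characterized by the recursion
`Mτ k = k·M_k(m) − Σ_{r=1}^{k−1} Mτ r · M_{k−r}(m)`).  Then for every `k ≥ 1`,
`Mτ k = Σ_{ρ ∈ NC(k)} (k + 1 − |ρ|) · fc_ρ(m)`. -/
theorem statement0
    (m : Measure ℝ) [IsProbabilityMeasure m]
    (hmom : ∀ n : ℕ, Integrable (fun x => x ^ n) m)
    (fc : ℕ → ℝ)
    (hfc : ∀ k : ℕ, 1 ≤ k →
      (∫ x, x ^ k ∂m) = ∑ ρ ∈ NCFinset k, ∏ B ∈ ρ, fc B.card)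
    (Mτ : ℕ → ℝ)
    (hMτ : ∀ k : ℕ, 1 ≤ k →
      Mτ k = k * (∫ x, x ^ k ∂m) - ∑ r ∈ Finset.Ico 1 k, Mτ r * (∫ x, x ^ (k - r) ∂m))
    (k : ℕ) (hk : 1 ≤ k) :
    Mτ k = ∑ ρ ∈ NCFinset k, ((k : ℝ) + 1 - ρ.card) * ∏ B ∈ ρ, fc B.card := by
  have hsum0 : NCFinset 0 = {∅} := ncPartitions_empty
  induction k using Nat.strong_induction_on with
  | _ k ih =>
    have h := mul_sum_NCFinset_eq fc k
    rw [← Finset.Nat.sum_antidiagonal_swap, Finset.Nat.sum_antidiagonal_eq_sum_range_succ_mk,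
      Finset.sum_range_succ, Finset.range_eq_Ico, Finset.sum_eq_sum_Ico_succ_bot hk] at h
    have hk0 : k ≠ 0 := by omega
    simp only [Prod.swap, hsum0, hk0, Nat.sub_self, Nat.sub_zero, Finset.sum_singleton,
      Finset.prod_empty, Finset.card_empty, if_true, if_false, Nat.cast_zero, sub_zero, zero_add,
      mul_one, sub_self, mul_zero, one_mul] at h
    have hsum : ∑ r ∈ Finset.Ico 1 k, Mτ r * (∫ x, x ^ (k - r) ∂m) =
        ∑ r ∈ Finset.Ico 1 k, (∑ ρ ∈ NCFinset (k - r), ∏ B ∈ ρ, fc B.card) *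
          ((∑ ρ ∈ NCFinset r, ((r : ℝ) + 1 - ρ.card) * ∏ B ∈ ρ, fc B.card) -
            if r = 0 then 1 else 0) := by
      refine Finset.sum_congr rfl fun r hr => ?_
      rw [Finset.mem_Ico] at hr
      rw [ih r hr.2 hr.1, hfc (k - r) (by omega), if_neg (by omega), sub_zero, mul_comm]
    rw [hMτ k hk, hfc k hk, h, hsum, add_sub_cancel_left]
end

section
/- For every k ≥ 2, every non-crossing partition ρ ∈ NC(k) has exactly |ρ| − 1 Kreweras decompositions; equivalently, ρ has exactly |ρ| − 1 inner partitions. -/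
open MeasureTheory Finset
open scoped Classical

/-- The unbarred copy of a block: `a ↦ 2a`.  In the interleaved linear order
`s₁ < s̄₁ < s₂ < s̄₂ < ⋯` on a set of points and their barred copies, the point `a`
is encoded as `2a` and its barred copy `ā` as `2a+1`. -/
def unbarred (B : Finset ℕ) : Finset ℕ := B.image (fun a => 2 * a)

/-- The barred copy of a block: `a ↦ 2a + 1`. -/
def barred (B : Finset ℕ) : Finset ℕ := B.image (fun a => 2 * a + 1)

/-- `ν` is the Kreweras complement of the non-crossing partition `ρ` of `S`:
`ν` is a partition of the barred copy of `S` (identified with `S`) such that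
`ρ ∪ ν` is non-crossing in the interleaved order, and `ν` is maximal (coarsest)
with this property, i.e. every other such partition refines it. -/
def IsKrewerasOn (S : Finset ℕ) (ρ ν : Finset (Finset ℕ)) : Prop :=
  IsNCPartitionOn S ρ ∧ IsPartitionOn S ν ∧
  IsNoncrossing (ρ.image unbarred ∪ ν.image barred) ∧
  ∀ ν', IsPartitionOn S ν' → IsNoncrossing (ρ.image unbarred ∪ ν'.image barred) →
    ∀ B ∈ ν', ∃ C ∈ ν, B ⊆ C

/-- `a` is a Kreweras point of the non-crossing partition `ρ` of `S`: the barred copy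
`ā` is the largest element of its block of the Kreweras complement `K(ρ)`
(with `K(ρ)` regarded as a partition of the barred copy of `S`, identified with `S`). -/
def IsKrewerasPoint (S : Finset ℕ) (ρ : Finset (Finset ℕ)) (a : ℕ) : Prop :=
  a ∈ S ∧ ∃ ν, IsKrewerasOn S ρ ν ∧ ∃ B ∈ ν, a ∈ B ∧ ∀ b ∈ B, b ≤ a

/-- `(ρout, ρin)` is a Kreweras decomposition of the non-crossing partition `ρ` of `S`:
`ρout` and `ρin` are nonempty disjoint subsets of `ρ` with union `ρ`, the support of
`ρin` is an interval `[i,j]` of `S`, and the barred copy of the largest point of the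
support of `ρout` lying below `i` (which must exist) is a Kreweras point of `ρout`. -/
def IsKrewerasDecomp (S : Finset ℕ) (ρ ρout ρin : Finset (Finset ℕ)) : Prop :=
  ρout ∪ ρin = ρ ∧ Disjoint ρout ρin ∧ ρout.Nonempty ∧ ρin.Nonempty ∧
  ∃ i ∈ S, ∃ j ∈ S, i ≤ j ∧
    ρin.sup id = S.filter (fun s => i ≤ s ∧ s ≤ j) ∧
    ∃ a ∈ S \ ρin.sup id, a < i ∧ (∀ b ∈ S \ ρin.sup id, b < i → b ≤ a) ∧
      IsKrewerasPoint (S \ ρin.sup id) ρout a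

namespace NoncrossingPartition

/-- No block of `ρ` meets both the interval between `x` (excluded) and `y` (included)
and its complement. -/
def Unseparated (ρ : Finset (Finset ℕ)) (x y : ℕ) : Prop :=
  ∀ B ∈ ρ, ∀ u ∈ B, ∀ v ∈ B, ((x < u ↔ y < u) ↔ (x < v ↔ y < v))

/-- The interval `[i, j]` is a union of blocks of `ρ`. -/
def IsSaturated (ρ : Finset (Finset ℕ)) (i j : ℕ) : Prop :=
  ∀ B ∈ ρ, ∀ u ∈ B, ∀ v ∈ B, u ∈ Icc i j → v ∈ Icc i j

lemma _root_.IsPartitionOn.eq_of_mem {S : Finset ℕ} {ρ : Finset (Finset ℕ)} (h : IsPartitionOn S ρ)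
    {B C : Finset ℕ} (hB : B ∈ ρ) (hC : C ∈ ρ) {x : ℕ} (hxB : x ∈ B) (hxC : x ∈ C) : B = C :=
  (h.2.2 x (h.2.1 B hB hxB)).unique ⟨hB, hxB⟩ ⟨hC, hxC⟩

lemma mem_unbarred {B : Finset ℕ} {x : ℕ} : x ∈ unbarred B ↔ ∃ a ∈ B, 2 * a = x := by
  simp [unbarred]

lemma mem_barred {B : Finset ℕ} {x : ℕ} : x ∈ barred B ↔ ∃ a ∈ B, 2 * a + 1 = x := by
  simp [barred]

/-- Two barred points in a common block of a non-crossing union are not separated. -/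
lemma unseparated_of_isNoncrossing {ρ ν : Finset (Finset ℕ)}
    (h : IsNoncrossing (ρ.image unbarred ∪ ν.image barred)) {B : Finset ℕ} (hB : B ∈ ν)
    {x y : ℕ} (hx : x ∈ B) (hy : y ∈ B) : Unseparated ρ x y := by
  intro C hC u hu v hv
  have hC' : unbarred C ∈ ρ.image unbarred ∪ ν.image barred :=
    mem_union_left _ (mem_image_of_mem _ hC)
  have hB' : barred B ∈ ρ.image unbarred ∪ ν.image barred :=
    mem_union_right _ (mem_image_of_mem _ hB)
  have hne : unbarred C ≠ barred B := by
    intro he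
    have : 2 * u ∈ barred B := he ▸ mem_unbarred.2 ⟨u, hu, rfl⟩
    obtain ⟨a, -, ha⟩ := mem_barred.1 this
    omega
  have hU : ∀ w ∈ C, 2 * w ∈ unbarred C := fun w hw => mem_unbarred.2 ⟨w, hw, rfl⟩
  have hV : ∀ w ∈ B, 2 * w + 1 ∈ barred B := fun w hw => mem_barred.2 ⟨w, hw, rfl⟩
  have key1 : ∀ a ∈ C, ∀ b ∈ C, ∀ c ∈ B, ∀ d ∈ B, ¬ (a ≤ c ∧ c < b ∧ b ≤ d) := by
    rintro a ha b hb c hc d hd ⟨h1, h2, h3⟩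
    exact h _ hC' _ hB' hne ⟨_, _, _, _, hU a ha, hU b hb, hV c hc, hV d hd,
      by omega, by omega, by omega⟩
  have key2 : ∀ a ∈ B, ∀ b ∈ B, ∀ c ∈ C, ∀ d ∈ C, ¬ (a < c ∧ c ≤ b ∧ b < d) := by
    rintro a ha b hb c hc d hd ⟨h1, h2, h3⟩
    exact h _ hB' _ hC' hne.symm ⟨_, _, _, _, hV a ha, hV b hb, hU c hc, hU d hd,
      by omega, by omega, by omega⟩
  have h1 := key1 u hu v hv x hx y hy
  have h2 := key1 u hu v hv y hy x hx
  have h3 := key1 v hv u hu x hx y hy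
  have h4 := key1 v hv u hu y hy x hx
  have h5 := key2 x hx y hy u hu v hv
  have h6 := key2 y hy x hx u hu v hv
  have h7 := key2 x hx y hy v hv u hu
  have h8 := key2 y hy x hx v hv u hu
  omega

lemma Unseparated.refl (ρ : Finset (Finset ℕ)) (x : ℕ) : Unseparated ρ x x :=
  fun _ _ _ _ _ _ => by tauto

lemma Unseparated.symm {ρ : Finset (Finset ℕ)} {x y : ℕ} (h : Unseparated ρ x y) :
    Unseparated ρ y x := by
  intro B hB u hu v hv
  have := h B hB u hu v hv
  tauto

lemma Unseparated.trans {ρ : Finset (Finset ℕ)} {x y z : ℕ} (h : Unseparated ρ x y)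
    (h' : Unseparated ρ y z) : Unseparated ρ x z := by
  intro B hB u hu v hv
  have := h B hB u hu v hv
  have := h' B hB u hu v hv
  tauto

/-- The Kreweras complement: the partition of `S` into classes of unseparated points. -/
noncomputable def krewerasComplement (S : Finset ℕ) (ρ : Finset (Finset ℕ)) :
    Finset (Finset ℕ) :=
  S.image fun x => S.filter (Unseparated ρ x)

lemma isPartitionOn_krewerasComplement (S : Finset ℕ) (ρ : Finset (Finset ℕ)) :
    IsPartitionOn S (krewerasComplement S ρ) := by
  refine ⟨?_, ?_, ?_⟩
  · intro B hB
    obtain ⟨x, hx, rfl⟩ := mem_image.1 hB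
    exact ⟨x, mem_filter.2 ⟨hx, .refl ρ x⟩⟩
  · intro B hB
    obtain ⟨x, hx, rfl⟩ := mem_image.1 hB
    exact filter_subset _ _
  · intro x hx
    refine ⟨_, ⟨mem_image_of_mem _ hx, mem_filter.2 ⟨hx, .refl ρ x⟩⟩, ?_⟩
    rintro C ⟨hC, hxC⟩
    obtain ⟨y, hy, rfl⟩ := mem_image.1 hC
    have hyx := (mem_filter.1 hxC).2
    ext z
    simp only [mem_filter]
    exact ⟨fun h => ⟨h.1, hyx.symm.trans h.2⟩, fun h => ⟨h.1, hyx.trans h.2⟩⟩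

lemma unseparated_of_mem_krewerasComplement {S : Finset ℕ} {ρ : Finset (Finset ℕ)}
    {B : Finset ℕ} (hB : B ∈ krewerasComplement S ρ) {x y : ℕ} (hx : x ∈ B) (hy : y ∈ B) :
    Unseparated ρ x y := by
  obtain ⟨z, -, rfl⟩ := mem_image.1 hB
  exact (mem_filter.1 hx).2.symm.trans (mem_filter.1 hy).2

lemma isNoncrossing_krewerasComplement {S : Finset ℕ} {ρ : Finset (Finset ℕ)}
    (h : IsNoncrossing ρ) :
    IsNoncrossing (ρ.image unbarred ∪ (krewerasComplement S ρ).image barred) := by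
  rintro B' hB' C' hC' hne ⟨a', b', c', d', ha, hb, hc, hd, hac, hcb, hbd⟩
  rcases mem_union.1 hB' with hB' | hB' <;> rcases mem_union.1 hC' with hC' | hC' <;>
    obtain ⟨B, hB, rfl⟩ := mem_image.1 hB' <;> obtain ⟨C, hC, rfl⟩ := mem_image.1 hC' <;>
    simp only [mem_unbarred, mem_barred] at ha hb hc hd <;>
    obtain ⟨a, ha, rfl⟩ := ha <;> obtain ⟨b, hb, rfl⟩ := hb <;>
    obtain ⟨c, hc, rfl⟩ := hc <;> obtain ⟨d, hd, rfl⟩ := hd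
  · exact h B hB C hC (fun e => hne (e ▸ rfl))
      ⟨a, b, c, d, ha, hb, hc, hd, by omega, by omega, by omega⟩
  · have := unseparated_of_mem_krewerasComplement hC hc hd B hB a ha b hb
    omega
  · have := unseparated_of_mem_krewerasComplement hB ha hb C hC c hc d hd
    omega
  · have hab := unseparated_of_mem_krewerasComplement hB ha hb
    have hcd := unseparated_of_mem_krewerasComplement hC hc hd
    have hac' : Unseparated ρ a c := by
      intro D hD u hu v hv
      have := hab D hD u hu v hv
      have := hcd D hD u hu v hv
      omega
    obtain ⟨x, -, rfl⟩ := mem_image.1 hB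
    have hcS := (isPartitionOn_krewerasComplement S ρ).2.1 C hC hc
    have hcB : c ∈ S.filter (Unseparated ρ x) :=
      mem_filter.2 ⟨hcS, (mem_filter.1 ha).2.trans hac'⟩
    exact hne (congrArg barred
      ((isPartitionOn_krewerasComplement S ρ).eq_of_mem hB hC hcB hc))

lemma isKrewerasOn_krewerasComplement {S : Finset ℕ} {ρ : Finset (Finset ℕ)}
    (h : IsNCPartitionOn S ρ) : IsKrewerasOn S ρ (krewerasComplement S ρ) := by
  refine ⟨h, isPartitionOn_krewerasComplement S ρ, isNoncrossing_krewerasComplement h.2, ?_⟩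
  intro ν' hν' hnc B hB
  obtain ⟨x, hx⟩ := hν'.1 B hB
  exact ⟨_, mem_image_of_mem _ (hν'.2.1 B hB hx), fun y hy =>
    mem_filter.2 ⟨hν'.2.1 B hB hy, unseparated_of_isNoncrossing hnc hB hx hy⟩⟩

lemma isKrewerasPoint_iff {S : Finset ℕ} {ρ : Finset (Finset ℕ)} (h : IsNCPartitionOn S ρ)
    {a : ℕ} : IsKrewerasPoint S ρ a ↔ a ∈ S ∧ ∀ b ∈ S, Unseparated ρ a b → b ≤ a := by
  refine and_congr_right fun ha => ⟨?_, fun hmax => ?_⟩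
  · rintro ⟨ν, hν, B, hB, haB, hmax⟩ b hb hab
    have hK := isKrewerasOn_krewerasComplement h
    obtain ⟨C, hC, hsub⟩ := hν.2.2.2 _ hK.2.1 hK.2.2.1 _ (mem_image_of_mem _ ha)
    have haC : a ∈ C := hsub (mem_filter.2 ⟨ha, .refl ρ a⟩)
    obtain rfl := hν.2.1.eq_of_mem hB hC haB haC
    exact hmax b (hsub (mem_filter.2 ⟨hb, hab⟩))
  · exact ⟨_, isKrewerasOn_krewerasComplement h, _, mem_image_of_mem _ ha,
      mem_filter.2 ⟨ha, .refl ρ a⟩,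
      fun b hb => hmax b (mem_filter.1 hb).1 (mem_filter.1 hb).2⟩

lemma sup_filter_subset_Icc {k i j : ℕ} {ρ : Finset (Finset ℕ)}
    (h : IsPartitionOn (Icc 1 k) ρ) (hi : 1 ≤ i) (hj : j ≤ k) (hs : IsSaturated ρ i j) :
    (ρ.filter (· ⊆ Icc i j)).sup id = Icc i j := by
  ext x
  simp only [mem_sup, mem_filter, id]
  constructor
  · rintro ⟨B, ⟨-, hB⟩, hx⟩
    exact hB hx
  · intro hx
    have hx' := mem_Icc.1 hx
    obtain ⟨B, ⟨hB, hxB⟩, -⟩ := h.2.2 x (mem_Icc.2 ⟨by omega, by omega⟩)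
    exact ⟨B, ⟨hB, fun y hy => hs B hB x hxB y hy hx⟩, hxB⟩

lemma isNCPartitionOn_sdiff {S : Finset ℕ} {i j : ℕ} {ρ : Finset (Finset ℕ)}
    (h : IsNCPartitionOn S ρ) (hs : IsSaturated ρ i j) :
    IsNCPartitionOn (S \ Icc i j) (ρ \ ρ.filter (· ⊆ Icc i j)) := by
  have hsub : ρ \ ρ.filter (· ⊆ Icc i j) ⊆ ρ := sdiff_subset
  refine ⟨⟨fun B hB => h.1.1 B (hsub hB), fun B hB x hx => ?_, fun x hx => ?_⟩,
    fun B hB C hC => h.2 B (hsub hB) C (hsub hC)⟩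
  · refine mem_sdiff.2 ⟨h.1.2.1 B (hsub hB) hx, fun hxI => (mem_sdiff.1 hB).2 ?_⟩
    exact mem_filter.2 ⟨hsub hB, fun y hy => hs B (hsub hB) x hx y hy hxI⟩
  · obtain ⟨hxS, hxI⟩ := mem_sdiff.1 hx
    obtain ⟨B, ⟨hB, hxB⟩, huniq⟩ := h.1.2.2 x hxS
    exact ⟨B, ⟨mem_sdiff.2 ⟨hB, fun hB' => hxI ((mem_filter.1 hB').2 hxB)⟩, hxB⟩,
      fun C hC => huniq C ⟨hsub hC.1, hC.2⟩⟩

/-- A Kreweras decomposition is given by an interval `[i, j]` with `i ≥ 2`, where `j` is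
maximal such that `[i, j]` is a union of blocks. -/
lemma isKrewerasDecomp_iff {k : ℕ} {ρ : Finset (Finset ℕ)}
    (h : IsNCPartitionOn (Icc 1 k) ρ) {o n : Finset (Finset ℕ)} :
    IsKrewerasDecomp (Icc 1 k) ρ o n ↔ ∃ i j, 2 ≤ i ∧ i ≤ j ∧ j ≤ k ∧ IsSaturated ρ i j ∧
      (∀ j', j < j' → j' ≤ k → ¬ IsSaturated ρ i j') ∧
      n = ρ.filter (· ⊆ Icc i j) ∧ o = ρ \ ρ.filter (· ⊆ Icc i j) := by
  constructor
  · rintro ⟨hon, hdisj, -, -, i, hi, j, hj, hij, hsup, a, ha, hai, hamax, hK⟩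
    rw [mem_Icc] at hi hj
    have hI : (Icc 1 k).filter (fun s => i ≤ s ∧ s ≤ j) = Icc i j := by
      ext x
      simp only [mem_filter, mem_Icc]
      omega
    rw [hI] at hsup
    rw [hsup] at ha hamax hK
    have hnρ : n ⊆ ρ := hon ▸ subset_union_right
    have hmem : ∀ B ∈ ρ, ∀ u ∈ B, u ∈ Icc i j → B ∈ n := by
      intro B hB u hu huI
      rw [← hsup, mem_sup] at huI
      obtain ⟨C, hC, huC⟩ := huI
      rwa [h.1.eq_of_mem hB (hnρ hC) hu huC]
    have hle : ∀ B ∈ n, B ⊆ Icc i j := fun B hB => hsup ▸ le_sup (f := id) hB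
    have hs : IsSaturated ρ i j := fun B hB u hu v hv huI => hle B (hmem B hB u hu huI) hv
    have hn : n = ρ.filter (· ⊆ Icc i j) := by
      ext B
      rw [mem_filter]
      refine ⟨fun hB => ⟨hnρ hB, hle B hB⟩, fun ⟨hB, hBI⟩ => ?_⟩
      obtain ⟨x, hx⟩ := h.1.1 B hB
      exact hmem B hB x hx (hBI hx)
    have ho : o = ρ \ ρ.filter (· ⊆ Icc i j) := by
      rw [← hn, ← hon, union_sdiff_right, sdiff_eq_self_of_disjoint hdisj]
    have ha1 := (mem_Icc.1 (mem_sdiff.1 ha).1).1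
    have hapred : a = i - 1 := by
      have := hamax (i - 1) (by simp only [mem_sdiff, mem_Icc]; omega) (by omega)
      omega
    refine ⟨i, j, by omega, hij, hj.2, hs, fun j' hjj' hj'k hs' => ?_, hn, ho⟩
    rw [ho, isKrewerasPoint_iff (isNCPartitionOn_sdiff h hs)] at hK
    have := hK.2 j' (by simp only [mem_sdiff, mem_Icc]; omega) (fun B hB u hu v hv => by
      have h1 := hs' B (mem_sdiff.1 hB).1 u hu v hv
      have h2 := hs' B (mem_sdiff.1 hB).1 v hv u hu
      simp only [mem_Icc] at h1 h2
      omega)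
    omega
  · rintro ⟨i, j, hi, hij, hjk, hs, hmax, rfl, rfl⟩
    have hsup := sup_filter_subset_Icc h.1 (by omega) hjk hs
    refine ⟨sdiff_union_of_subset (filter_subset _ _), sdiff_disjoint, ?_, ?_,
      i, mem_Icc.2 ⟨by omega, by omega⟩, j, mem_Icc.2 ⟨by omega, hjk⟩, hij, ?_, i - 1, ?_⟩
    · obtain ⟨B, ⟨hB, hxB⟩, -⟩ := h.1.2.2 1 (mem_Icc.2 ⟨le_rfl, by omega⟩)
      refine ⟨B, mem_sdiff.2 ⟨hB, fun hB' => ?_⟩⟩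
      have := mem_Icc.1 ((mem_filter.1 hB').2 hxB)
      omega
    · obtain ⟨B, ⟨hB, hxB⟩, -⟩ := h.1.2.2 i (mem_Icc.2 ⟨by omega, by omega⟩)
      exact ⟨B, mem_filter.2 ⟨hB, fun y hy =>
        hs B hB i hxB y hy (mem_Icc.2 ⟨le_rfl, hij⟩)⟩⟩
    · rw [hsup]
      ext x
      simp only [mem_filter, mem_Icc]
      omega
    · rw [hsup, isKrewerasPoint_iff (isNCPartitionOn_sdiff h hs)]
      have ha : i - 1 ∈ Icc 1 k \ Icc i j := by
        simp only [mem_sdiff, mem_Icc]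
        omega
      refine ⟨ha, by omega, fun b _ hb => by omega, ha, fun b hb hR => ?_⟩
      by_contra! hlt
      simp only [mem_sdiff, mem_Icc] at hb
      refine hmax b (by omega) (by omega) fun B hB u hu v hv huI => ?_
      by_cases hBn : B ⊆ Icc i j
      · have := mem_Icc.1 (hBn hv)
        rw [mem_Icc]
        omega
      · have := hR B (mem_sdiff.2 ⟨hB, fun hB' => hBn (mem_filter.1 hB').2⟩) u hu v hv
        rw [mem_Icc] at huI ⊢
        omega

/-- The convex hull of a block of a non-crossing partition is a union of blocks. -/
lemma isSaturated_min'_max' {S : Finset ℕ} {ρ : Finset (Finset ℕ)} (h : IsNCPartitionOn S ρ)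
    {B : Finset ℕ} (hB : B ∈ ρ) (hne : B.Nonempty) :
    IsSaturated ρ (B.min' hne) (B.max' hne) := by
  intro C hC u hu v hv huI
  rw [mem_Icc] at huI ⊢
  by_cases hBC : B = C
  · subst hBC
    exact ⟨B.min'_le v hv, B.le_max' v hv⟩
  · have hmin := B.min'_mem hne
    have hmax := B.max'_mem hne
    have huB : u ∉ B := fun huB => hBC (h.1.eq_of_mem hB hC huB hu)
    have hvB : v ∉ B := fun hvB => hBC (h.1.eq_of_mem hB hC hvB hv)
    have h1 : B.min' hne ≠ u := fun e => huB (e ▸ hmin)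
    have h2 : B.max' hne ≠ u := fun e => huB (e ▸ hmax)
    by_contra hcon
    by_cases hv' : v < B.min' hne
    · exact h.2 C hC B hB (Ne.symm hBC)
        ⟨v, u, _, _, hv, hu, hmin, hmax, hv', by omega, by omega⟩
    · exact h.2 B hB C hC hBC
        ⟨_, _, u, v, hmin, hmax, hu, hv, by omega, by omega, by omega⟩

lemma exists_maximal_isSaturated {k : ℕ} {ρ : Finset (Finset ℕ)}
    (h : IsNCPartitionOn (Icc 1 k) ρ) {B : Finset ℕ} (hB : B ∈ ρ) :
    ∃ i j, i ∈ B ∧ (∀ u ∈ B, i ≤ u) ∧ i ≤ j ∧ j ≤ k ∧ IsSaturated ρ i j ∧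
      ∀ j', j < j' → j' ≤ k → ¬ IsSaturated ρ i j' := by
  have hne := h.1.1 B hB
  have hmax := mem_Icc.1 (h.1.2.1 B hB (B.max'_mem hne))
  obtain ⟨j, hj, hjmax⟩ := exists_max_image
    ((Icc (B.min' hne) k).filter (IsSaturated ρ (B.min' hne))) id
    ⟨B.max' hne, mem_filter.2 ⟨mem_Icc.2 ⟨B.min'_le_max' hne, hmax.2⟩,
      isSaturated_min'_max' h hB hne⟩⟩
  simp only [mem_filter, mem_Icc, id] at hj hjmax
  refine ⟨_, j, B.min'_mem hne, B.min'_le, hj.1.1, hj.1.2, hj.2, fun j' hlt hle hs => ?_⟩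
  have := hjmax j' ⟨⟨by omega, hle⟩, hs⟩
  omega

end NoncrossingPartition

open NoncrossingPartition in
/-- For every `k ≥ 2`, every non-crossing partition `ρ ∈ NC(k)` has
exactly `|ρ| − 1` Kreweras decompositions. -/
theorem statement2 (k : ℕ) (hk : 2 ≤ k) (ρ : Finset (Finset ℕ))
    (hρ : IsNCPartitionOn (Finset.Icc 1 k) ρ) :
    ((ρ.powerset ×ˢ ρ.powerset).filter
        (fun p => IsKrewerasDecomp (Finset.Icc 1 k) ρ p.1 p.2)).card
      = ρ.card - 1 := by
  obtain ⟨B₁, ⟨hB₁, h1⟩, huniq⟩ := hρ.1.2.2 1 (mem_Icc.2 ⟨le_rfl, by omega⟩)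
  rw [← card_erase_of_mem hB₁]
  choose! i j hiB himin hij hjk hs hmax using
    fun B (hB : B ∈ ρ) => exists_maximal_isSaturated hρ hB
  have hpos : ∀ B ∈ ρ, 1 ≤ i B := fun B hB =>
    (mem_Icc.1 (hρ.1.2.1 B hB (hiB B hB))).1
  symm
  refine card_bij (fun B _ => (ρ \ ρ.filter (· ⊆ Icc (i B) (j B)),
    ρ.filter (· ⊆ Icc (i B) (j B)))) ?_ ?_ ?_
  · intro B hB
    obtain ⟨hne, hB⟩ := mem_erase.1 hB
    refine mem_filter.2 ⟨mem_product.2 ⟨mem_powerset.2 sdiff_subset,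
      mem_powerset.2 (filter_subset _ _)⟩, (isKrewerasDecomp_iff hρ).2
      ⟨i B, j B, ?_, hij B hB, hjk B hB, hs B hB, hmax B hB, rfl, rfl⟩⟩
    have hi1 : i B ≠ 1 := fun e => hne (huniq B ⟨hB, e ▸ hiB B hB⟩)
    have := hpos B hB
    omega
  · intro B hB C hC he
    replace hB := mem_of_mem_erase hB
    replace hC := mem_of_mem_erase hC
    have hsup := congrArg (fun p => p.2.sup id) he
    simp only [sup_filter_subset_Icc hρ.1 (hpos B hB) (hjk B hB) (hs B hB),
      sup_filter_subset_Icc hρ.1 (hpos C hC) (hjk C hC) (hs C hC)] at hsup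
    have hb : i B ∈ Icc (i C) (j C) := hsup ▸ left_mem_Icc.2 (hij B hB)
    have hc : i C ∈ Icc (i B) (j B) := hsup ▸ left_mem_Icc.2 (hij C hC)
    have hi : i B = i C := le_antisymm (mem_Icc.1 hc).1 (mem_Icc.1 hb).1
    exact hρ.1.eq_of_mem hB hC (hiB B hB) (hi ▸ hiB C hC)
  · rintro ⟨o, n⟩ hp
    obtain ⟨a, b, ha, hab, hbk, hsab, hmaxab, rfl, rfl⟩ :=
      (isKrewerasDecomp_iff hρ).1 (mem_filter.1 hp).2
    obtain ⟨B, ⟨hB, haB⟩, -⟩ := hρ.1.2.2 a (mem_Icc.2 ⟨by omega, by omega⟩)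
    have hle : ∀ u ∈ B, a ≤ u := fun u hu =>
      (mem_Icc.1 (hsab B hB a haB u hu (left_mem_Icc.2 hab))).1
    have hia : i B = a := le_antisymm (himin B hB a haB) (hle _ (hiB B hB))
    have hjb : j B = b := by
      have hsB := hs B hB
      have hmaxB := hmax B hB
      rw [hia] at hsB hmaxB
      rcases lt_trichotomy (j B) b with hlt | heq | hlt
      · exact absurd hsab (hmaxB b hlt hbk)
      · exact heq
      · exact absurd hsB (hmaxab _ hlt (hjk B hB))
    refine ⟨B, mem_erase.2 ⟨?_, hB⟩, by rw [hia, hjb]⟩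
    rintro rfl
    have := hle 1 h1
    omega
end

section
/- Let ρ ∈ NC(k) and suppose the block of ρ containing 1 divides {1,…,k} into the (nonempty) segments I_1, …, I_l, i.e., the maximal intervals of {1,…,k} disjoint from that block. Then: (a) for each j, the restriction ρ_j := ρ|_{I_j} (the set of blocks of ρ contained in I_j) is an inner partition of ρ; (b) every inner partition of ρ_j (with ρ_j regarded, after order-preserving relabeling, as a non-crossing partition of {1,…,|I_j|}) is an inner partition of ρ; and (c) conversely, every inner partition of ρ equals some ρ_j or is an inner partition of some ρ_j. -/
open MeasureTheory Finset
open scoped Classical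

/-- `ρin` is an inner partition of `ρ` (as a partition of `S`): together with
`ρ ∖ ρin` it forms a Kreweras decomposition of `ρ`. -/
def IsInner (S : Finset ℕ) (ρ ρin : Finset (Finset ℕ)) : Prop :=
  IsKrewerasDecomp S ρ (ρ \ ρin) ρin

/-- `T` is a set of consecutive integers. -/
def IsConsecutive (T : Finset ℕ) : Prop :=
  ∀ x ∈ T, ∀ z ∈ T, ∀ y : ℕ, x ≤ y → y ≤ z → y ∈ T

/-- `T` is one of the segments into which the block `B` divides `S`: a maximal
interval of consecutive integers contained in `S` and disjoint from `B`. -/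
def IsGapSegment (S B T : Finset ℕ) : Prop :=
  T.Nonempty ∧ T ⊆ S \ B ∧ IsConsecutive T ∧
  ∀ T' : Finset ℕ, T'.Nonempty → T' ⊆ S \ B → IsConsecutive T' → T ⊆ T' → T' = T

/-- The block `C` meets both the half-open interval `(a, b]` and its complement. -/
def Separates (C : Finset ℕ) (a b : ℕ) : Prop :=
  ∃ x ∈ C, ∃ y ∈ C, a < x ∧ x ≤ b ∧ (y ≤ a ∨ b < y)

/-- No block of `ρ` separates the barred copies of `a` and `b`. -/
def Unseparated (ρ : Finset (Finset ℕ)) (a b : ℕ) : Prop :=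
  ∀ C ∈ ρ, ¬ Separates C a b ∧ ¬ Separates C b a

theorem Unseparated.refl (ρ : Finset (Finset ℕ)) (a : ℕ) : Unseparated ρ a a := by
  intro C _
  constructor <;> (rintro ⟨x, _, y, _, h⟩; omega)

theorem Unseparated.symm {ρ : Finset (Finset ℕ)} {a b : ℕ} (h : Unseparated ρ a b) :
    Unseparated ρ b a := fun C hC => (h C hC).symm

theorem unseparated_iff {ρ : Finset (Finset ℕ)} {a b : ℕ} :
    Unseparated ρ a b ↔ ∀ C ∈ ρ, ∀ x ∈ C, ∀ y ∈ C,
      ((a < x ∧ x ≤ b) ∨ (b < x ∧ x ≤ a)) → ((a < y ∧ y ≤ b) ∨ (b < y ∧ y ≤ a)) := by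
  constructor
  · intro h C hC x hx y hy hxy
    by_contra hcon
    rcases hxy with h' | h'
    · exact (h C hC).1 ⟨x, hx, y, hy, h'.1, h'.2, by omega⟩
    · exact (h C hC).2 ⟨x, hx, y, hy, h'.1, h'.2, by omega⟩
  · intro h C hC
    constructor
    · rintro ⟨x, hx, y, hy, h'⟩
      have := h C hC x hx y hy
      omega
    · rintro ⟨x, hx, y, hy, h'⟩
      have := h C hC x hx y hy
      omega

theorem Unseparated.trans {ρ : Finset (Finset ℕ)} {a b c : ℕ} (h : Unseparated ρ a b)
    (h' : Unseparated ρ b c) : Unseparated ρ a c := by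
  rw [unseparated_iff] at *
  intro C hC x hx y hy
  have h₁ := h C hC x hx y hy
  have h₂ := h' C hC x hx y hy
  have h₃ := h C hC y hy x hx
  have h₄ := h' C hC y hy x hx
  omega

/-- The points of `S` whose barred copies are not separated from that of `a` by `ρ`. -/
noncomputable def unseparatedClass (S : Finset ℕ) (ρ : Finset (Finset ℕ)) (a : ℕ) : Finset ℕ :=
  S.filter (Unseparated ρ a)

theorem mem_unseparatedClass {S : Finset ℕ} {ρ : Finset (Finset ℕ)} {a b : ℕ} :
    b ∈ unseparatedClass S ρ a ↔ b ∈ S ∧ Unseparated ρ a b := by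
  simp [unseparatedClass]

theorem unseparatedClass_eq {S : Finset ℕ} {ρ : Finset (Finset ℕ)} {a b : ℕ}
    (h : Unseparated ρ a b) : unseparatedClass S ρ a = unseparatedClass S ρ b := by
  ext x
  rw [mem_unseparatedClass, mem_unseparatedClass]
  exact ⟨fun hx => ⟨hx.1, h.symm.trans hx.2⟩, fun hx => ⟨hx.1, h.trans hx.2⟩⟩

/-- The classes of unseparated points form the Kreweras complement. -/
theorem isKrewerasOn_image_unseparatedClass {S : Finset ℕ} {ρ : Finset (Finset ℕ)}
    (hρ : IsNCPartitionOn S ρ) :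
    IsKrewerasOn S ρ (S.image (unseparatedClass S ρ)) := by
  refine ⟨hρ, ⟨?_, ?_, ?_⟩, ?_, ?_⟩
  · intro B hB
    obtain ⟨a, ha, rfl⟩ := mem_image.1 hB
    exact ⟨a, mem_unseparatedClass.2 ⟨ha, .refl ρ a⟩⟩
  · intro B hB
    obtain ⟨a, ha, rfl⟩ := mem_image.1 hB
    exact filter_subset _ _
  · intro x hx
    refine ⟨unseparatedClass S ρ x,
      ⟨mem_image_of_mem _ hx, mem_unseparatedClass.2 ⟨hx, .refl ρ x⟩⟩, ?_⟩
    rintro C ⟨hC, hxC⟩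
    obtain ⟨a, ha, rfl⟩ := mem_image.1 hC
    exact unseparatedClass_eq (mem_unseparatedClass.1 hxC).2
  · intro B hB C hC hne
    rintro ⟨a, b, c, d, ha, hb, hc, hd, h₁, h₂, h₃⟩
    rcases mem_union.1 hB with hB | hB <;> rcases mem_union.1 hC with hC | hC <;>
      obtain ⟨B, hBmem, rfl⟩ := mem_image.1 hB <;> obtain ⟨C, hCmem, rfl⟩ := mem_image.1 hC <;>
      clear hB hC <;>
      simp only [unbarred, barred, mem_image] at ha hb hc hd <;>
      obtain ⟨a, ha, rfl⟩ := ha <;> obtain ⟨b, hb, rfl⟩ := hb <;>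
      obtain ⟨c, hc, rfl⟩ := hc <;> obtain ⟨d, hd, rfl⟩ := hd
    · exact hρ.2 B hBmem C hCmem (fun h => hne (by rw [h]))
        ⟨a, b, c, d, ha, hb, hc, hd, by omega, by omega, by omega⟩
    · obtain ⟨e, _, rfl⟩ := mem_image.1 hCmem
      have hcd := (mem_unseparatedClass.1 hc).2.symm.trans (mem_unseparatedClass.1 hd).2
      have := unseparated_iff.1 hcd B hBmem b hb a ha
      omega
    · obtain ⟨e, _, rfl⟩ := mem_image.1 hBmem
      have hab := (mem_unseparatedClass.1 ha).2.symm.trans (mem_unseparatedClass.1 hb).2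
      have := unseparated_iff.1 hab C hCmem c hc d hd
      omega
    · obtain ⟨e, _, rfl⟩ := mem_image.1 hBmem
      obtain ⟨f, _, rfl⟩ := mem_image.1 hCmem
      have hea := (mem_unseparatedClass.1 ha).2
      have hfc := (mem_unseparatedClass.1 hc).2
      have hab := hea.symm.trans (mem_unseparatedClass.1 hb).2
      have hcd := hfc.symm.trans (mem_unseparatedClass.1 hd).2
      have hac : Unseparated ρ a c := by
        rw [unseparated_iff] at hab hcd ⊢
        intro D hD x hx y hy
        have h₄ := hab D hD x hx y hy
        have h₅ := hcd D hD y hy x hx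
        omega
      exact hne (by rw [unseparatedClass_eq (hea.trans (hac.trans hfc.symm))])
  · intro ν hν hnc B hB
    obtain ⟨a, ha⟩ := hν.1 B hB
    refine ⟨_, mem_image_of_mem _ (hν.2.1 B hB ha), fun b hb => ?_⟩
    refine mem_unseparatedClass.2 ⟨hν.2.1 B hB hb, ?_⟩
    have key : ∀ p ∈ B, ∀ q ∈ B, ∀ C ∈ ρ, ¬ Separates C p q := by
      rintro p hp q hq C hC ⟨x, hx, y, hy, h₁, h₂, h₃⟩
      have hB' : barred B ∈ ρ.image unbarred ∪ ν.image barred :=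
        mem_union_right _ (mem_image_of_mem _ hB)
      have hC' : unbarred C ∈ ρ.image unbarred ∪ ν.image barred :=
        mem_union_left _ (mem_image_of_mem _ hC)
      have hp' : 2 * p + 1 ∈ barred B := mem_image_of_mem _ hp
      have hq' : 2 * q + 1 ∈ barred B := mem_image_of_mem _ hq
      have hx' : 2 * x ∈ unbarred C := mem_image_of_mem _ hx
      have hy' : 2 * y ∈ unbarred C := mem_image_of_mem _ hy
      have hne : barred B ≠ unbarred C := by
        intro h
        rw [h] at hp'
        obtain ⟨z, _, hz⟩ := mem_image.1 hp'
        omega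
      rcases h₃ with h₃ | h₃
      · exact hnc _ hC' _ hB' hne.symm
          ⟨2 * y, 2 * x, 2 * p + 1, 2 * q + 1, hy', hx', hp', hq', by omega, by omega, by omega⟩
      · exact hnc _ hB' _ hC' hne
          ⟨2 * p + 1, 2 * q + 1, 2 * x, 2 * y, hp', hq', hx', hy', by omega, by omega, by omega⟩
    exact fun C hC => ⟨key a ha b hb C hC, key b hb a ha C hC⟩

theorem isKrewerasPoint_iff {S : Finset ℕ} {ρ : Finset (Finset ℕ)} (hρ : IsNCPartitionOn S ρ)
    {a : ℕ} :
    IsKrewerasPoint S ρ a ↔ a ∈ S ∧ ∀ b ∈ S, a < b → ∃ C ∈ ρ, Separates C a b := by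
  have hK := isKrewerasOn_image_unseparatedClass hρ
  refine and_congr_right fun ha => ?_
  have hmem : unseparatedClass S ρ a ∈ S.image (unseparatedClass S ρ) := mem_image_of_mem _ ha
  have haa : a ∈ unseparatedClass S ρ a := mem_unseparatedClass.2 ⟨ha, .refl ρ a⟩
  constructor
  · rintro ⟨ν, hν, B, hB, haB, hmax⟩ b hb hab
    by_contra! hcon
    obtain ⟨C, hC, hsub⟩ := hν.2.2.2 _ hK.2.1 hK.2.2.1 _ hmem
    have hCB : C = B := (hν.2.1.2.2 a ha).unique ⟨hC, hsub haa⟩ ⟨hB, haB⟩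
    subst hCB
    have hbC : b ∈ unseparatedClass S ρ a := by
      refine mem_unseparatedClass.2 ⟨hb, fun D hD => ⟨hcon D hD, ?_⟩⟩
      rintro ⟨x, _, y, _, h⟩
      omega
    have := hmax b (hsub hbC)
    omega
  · intro h
    refine ⟨_, hK, _, hmem, haa, fun b hb => ?_⟩
    by_contra! hab
    obtain ⟨hbS, hu⟩ := mem_unseparatedClass.1 hb
    obtain ⟨C, hC, hs⟩ := h b hbS hab
    exact (hu C hC).1 hs

theorem IsNCPartitionOn.sdiff {S : Finset ℕ} {ρ σ : Finset (Finset ℕ)}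
    (hρ : IsNCPartitionOn S ρ) (hσ : σ ⊆ ρ) : IsNCPartitionOn (S \ σ.sup id) (ρ \ σ) := by
  obtain ⟨⟨h₁, h₂, h₃⟩, h₄⟩ := hρ
  refine ⟨⟨fun B hB => h₁ B (mem_sdiff.1 hB).1, fun B hB x hx => ?_, fun x hx => ?_⟩,
    fun B hB C hC => h₄ B (mem_sdiff.1 hB).1 C (mem_sdiff.1 hC).1⟩
  · obtain ⟨hB, hBσ⟩ := mem_sdiff.1 hB
    refine mem_sdiff.2 ⟨h₂ B hB hx, fun h => hBσ ?_⟩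
    obtain ⟨C, hC, hxC⟩ := mem_sup.1 h
    rwa [(h₃ x (h₂ B hB hx)).unique ⟨hB, hx⟩ ⟨hσ hC, hxC⟩]
  · obtain ⟨hx, hxσ⟩ := mem_sdiff.1 hx
    obtain ⟨B, ⟨hB, hxB⟩, hu⟩ := h₃ x hx
    refine ⟨B, ⟨mem_sdiff.2 ⟨hB, fun h => hxσ (mem_sup.2 ⟨B, h, hxB⟩)⟩, hxB⟩, ?_⟩
    exact fun C hC => hu C ⟨(mem_sdiff.1 hC.1).1, hC.2⟩

theorem isInner_iff {S : Finset ℕ} {ρ σ : Finset (Finset ℕ)} (hρ : IsNCPartitionOn S ρ) :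
    IsInner S ρ σ ↔ σ ⊆ ρ ∧ (ρ \ σ).Nonempty ∧ σ.Nonempty ∧
      ∃ i ∈ S, ∃ j ∈ S, i ≤ j ∧ (∀ x, (∃ C ∈ σ, x ∈ C) ↔ x ∈ S ∧ i ≤ x ∧ x ≤ j) ∧
        ∃ a ∈ S, a < i ∧ (∀ b ∈ S, b < i → b ≤ a) ∧
          ∀ b ∈ S, j < b → ∃ C ∈ ρ \ σ, Separates C a b := by
  have hsup : ∀ i j, σ.sup id = S.filter (fun s => i ≤ s ∧ s ≤ j) ↔
      ∀ x, (∃ C ∈ σ, x ∈ C) ↔ x ∈ S ∧ i ≤ x ∧ x ≤ j := by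
    intro i j
    simp [Finset.ext_iff, mem_sup]
  constructor
  · rintro ⟨hun, -, hout, hin, i, hi, j, hj, hij, hs, a, ha, hai, hmax, hk⟩
    have hσ : σ ⊆ ρ := hun ▸ subset_union_right
    refine ⟨hσ, hout, hin, i, hi, j, hj, hij, (hsup i j).1 hs, a, (mem_sdiff.1 ha).1, hai, ?_, ?_⟩
    · refine fun b hb hbi => hmax b (mem_sdiff.2 ⟨hb, ?_⟩) hbi
      rw [hs, mem_filter]
      omega
    · refine fun b hb hbj => ((isKrewerasPoint_iff (hρ.sdiff hσ)).1 hk).2 b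
        (mem_sdiff.2 ⟨hb, ?_⟩) (by omega)
      rw [hs, mem_filter]
      omega
  · rintro ⟨hσ, hout, hin, i, hi, j, hj, hij, hs, a, ha, hai, hmax, hk⟩
    rw [← hsup] at hs
    have ha' : a ∈ S \ σ.sup id := by
      rw [hs, mem_sdiff, mem_filter]
      exact ⟨ha, by omega⟩
    refine ⟨sdiff_union_of_subset hσ, sdiff_disjoint, hout, hin, i, hi, j, hj, hij, hs,
      a, ha', hai, fun b hb => hmax b (mem_sdiff.1 hb).1,
      (isKrewerasPoint_iff (hρ.sdiff hσ)).2 ⟨ha', fun b hb hab => hk b (mem_sdiff.1 hb).1 ?_⟩⟩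
    by_contra! hbj
    rw [mem_sdiff, hs, mem_filter] at hb
    have := hmax b hb.1
    exact hb.2 ⟨hb.1, by by_contra; omega, hbj⟩

theorem isGapSegment_iff {k : ℕ} {B T : Finset ℕ} (h1 : 1 ∈ B) :
    IsGapSegment (Icc 1 k) B T ↔ ∃ p q, p < q ∧ q ≤ k ∧ T = Icc (p + 1) q ∧
      1 ≤ p ∧ p ∈ B ∧ (q = k ∨ q + 1 ∈ B) ∧ ∀ x ∈ B, ¬ (p < x ∧ x ≤ q) := by
  constructor
  · rintro ⟨hne, hsub, hcon, hmax⟩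
    obtain ⟨i, hi, hil⟩ : ∃ i ∈ T, ∀ x ∈ T, i ≤ x := ⟨_, T.min'_mem hne, T.min'_le⟩
    obtain ⟨j, hj, hjl⟩ : ∃ j ∈ T, ∀ x ∈ T, x ≤ j := ⟨_, T.max'_mem hne, T.le_max'⟩
    have hT : ∀ x, x ∈ T ↔ i ≤ x ∧ x ≤ j :=
      fun x => ⟨fun hx => ⟨hil x hx, hjl x hx⟩, fun hx => hcon i hi j hj x hx.1 hx.2⟩
    have hS : ∀ x ∈ T, (1 ≤ x ∧ x ≤ k) ∧ x ∉ B := by simpa [subset_iff] using hsub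
    have hi' := hS i hi
    have hj' := hS j hj
    have hij := hil j hj
    have hi1 : i ≠ 1 := fun h => hi'.2 (h ▸ h1)
    have hext : ∀ y, 1 ≤ y → y ≤ k → (y + 1 = i ∨ y = j + 1) → y ∈ B := by
      intro y hy hyk hyij
      by_contra hyB
      have := hmax (insert y T) (insert_nonempty _ _) ?_ ?_ (subset_insert _ _)
      · have := (hT y).1 (this ▸ mem_insert_self y T)
        omega
      · intro x hx
        rcases mem_insert.1 hx with rfl | hx
        · simp [hy, hyk, hyB]
        · exact hsub hx
      · intro x hx z hz w hxw hwz
        simp only [mem_insert, hT] at hx hz ⊢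
        omega
    refine ⟨i - 1, j, by omega, hj'.1.2, ?_, by omega, hext _ (by omega) (by omega) (by omega),
      ?_, fun x hx hxT => (hS x ((hT x).2 (by omega))).2 hx⟩
    · ext x
      rw [hT, mem_Icc]
      omega
    · by_cases h : j = k
      · exact .inl h
      · exact .inr (hext _ (by omega) (by omega) (by omega))
  · rintro ⟨p, q, hpq, hqk, rfl, hp1, hpB, hq, hB⟩
    refine ⟨⟨q, by simp; omega⟩, fun x hx => ?_, fun x hx z hz y hxy hyz => ?_,
      fun T' _ hsub hcon hTT' => Subset.antisymm (fun x hx => ?_) hTT'⟩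
    · have hx' := mem_Icc.1 hx
      refine mem_sdiff.2 ⟨mem_Icc.2 (by omega), fun h => hB x h (by omega)⟩
    · rw [mem_Icc] at *
      omega
    · have hqT : q ∈ T' := hTT' (mem_Icc.2 (by omega))
      have hxs := mem_Icc.1 (mem_sdiff.1 (hsub hx)).1
      rw [mem_Icc]
      by_contra hxpq
      rcases Nat.lt_or_ge p x with h | h
      · rcases hq with hq | hq
        · omega
        · exact (mem_sdiff.1 (hsub (hcon q hqT x hx (q + 1) (by omega) (by omega)))).2 hq
      · exact (mem_sdiff.1 (hsub (hcon x hx q hqT p h hpq.le))).2 hpB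

/-- An interval avoiding the block of `1` lies in one of the segments cut out by that block. -/
theorem exists_isGapSegment {k i j : ℕ} {B : Finset ℕ} (hBk : B ⊆ Icc 1 k) (h1 : 1 ∈ B)
    (hi : 1 < i) (hij : i ≤ j) (hjk : j ≤ k) (hB : ∀ x ∈ B, ¬ (i ≤ x ∧ x ≤ j)) :
    ∃ p q, p < i ∧ j ≤ q ∧ q ≤ k ∧ 1 ≤ p ∧ p ∈ B ∧ (q = k ∨ q + 1 ∈ B) ∧
      ∀ x ∈ B, ¬ (p < x ∧ x ≤ q) := by
  have hne : (B.filter (· < i)).Nonempty := ⟨1, mem_filter.2 ⟨h1, hi⟩⟩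
  obtain ⟨p, hp, hpl⟩ : ∃ p ∈ B.filter (· < i), ∀ x ∈ B.filter (· < i), x ≤ p :=
    ⟨_, max'_mem _ hne, le_max' _⟩
  obtain ⟨hpB, hpi⟩ := mem_filter.1 hp
  have hp1 := (mem_Icc.1 (hBk hpB)).1
  have hpl' : ∀ x ∈ B, x < i → x ≤ p := fun x hx hxi => hpl x (mem_filter.2 ⟨hx, hxi⟩)
  by_cases hne' : (B.filter (j < ·)).Nonempty
  · obtain ⟨r, hr, hrl⟩ : ∃ r ∈ B.filter (j < ·), ∀ x ∈ B.filter (j < ·), r ≤ x :=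
      ⟨_, min'_mem _ hne', min'_le _⟩
    obtain ⟨hrB, hjr⟩ := mem_filter.1 hr
    have hrk := mem_Icc.1 (hBk hrB)
    refine ⟨p, r - 1, hpi, by omega, by omega, hp1, hpB,
      .inr (by rwa [Nat.sub_add_cancel hrk.1]), fun x hx hxpr => ?_⟩
    have h₁ := hpl' x hx
    have h₂ := hB x hx
    have h₃ : j < x → r ≤ x := fun h => hrl x (mem_filter.2 ⟨hx, h⟩)
    omega
  · refine ⟨p, k, hpi, hjk, le_rfl, hp1, hpB, .inl rfl, fun x hx hxp => ?_⟩
    have h₁ := hpl' x hx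
    have h₂ := hB x hx
    have h₃ : ¬ j < x := fun h => hne' ⟨x, mem_filter.2 ⟨hx, h⟩⟩
    omega

/-- A block meeting a segment cut out by the block of `1` is contained in that segment. -/
theorem IsNCPartitionOn.subset_segment {k p q : ℕ} {ρ : Finset (Finset ℕ)} {B C : Finset ℕ}
    (hρ : IsNCPartitionOn (Icc 1 k) ρ) (hB : B ∈ ρ) (h1 : 1 ∈ B) (hpB : p ∈ B)
    (hq : q = k ∨ q + 1 ∈ B) (hgap : ∀ x ∈ B, ¬ (p < x ∧ x ≤ q)) (hC : C ∈ ρ) {x : ℕ}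
    (hx : x ∈ C) (hpx : p < x) (hxq : x ≤ q) : C ⊆ Icc (p + 1) q := by
  have hBC : B ≠ C := by
    rintro rfl
    exact hgap x hx ⟨hpx, hxq⟩
  have hdisj : ∀ y ∈ C, y ∉ B := fun y hy hyB =>
    hBC ((hρ.1.2.2 y (hρ.1.2.1 C hC hy)).unique ⟨hB, hyB⟩ ⟨hC, hy⟩)
  intro y hy
  have hyk := mem_Icc.1 (hρ.1.2.1 C hC hy)
  have hy1 : y ≠ 1 := fun h => hdisj y hy (h ▸ h1)
  have hyp : y ≠ p := fun h => hdisj y hy (h ▸ hpB)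
  rw [mem_Icc]
  by_contra hypq
  rcases Nat.lt_or_ge y p with h | h
  · exact hρ.2 B hB C hC hBC ⟨1, p, y, x, h1, hpB, hy, hx, by omega, h, hpx⟩
  · rcases hq with hq | hq
    · omega
    · have hyq : y ≠ q + 1 := fun h => hdisj y hy (h ▸ hq)
      exact hρ.2 B hB C hC hBC
        ⟨p, q + 1, x, y, hpB, hq, hx, hy, hpx, by omega, by omega⟩

theorem IsNCPartitionOn.filter_subset {S T : Finset ℕ} {ρ : Finset (Finset ℕ)}
    (hρ : IsNCPartitionOn S ρ) (hTS : T ⊆ S)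
    (hT : ∀ C ∈ ρ, ∀ x ∈ C, x ∈ T → C ⊆ T) : IsNCPartitionOn T (ρ.filter (· ⊆ T)) := by
  refine ⟨⟨fun C hC => hρ.1.1 C (mem_filter.1 hC).1, fun C hC => (mem_filter.1 hC).2,
    fun x hx => ?_⟩, fun C hC D hD => hρ.2 C (mem_filter.1 hC).1 D (mem_filter.1 hD).1⟩
  obtain ⟨C, ⟨hC, hxC⟩, hu⟩ := hρ.1.2.2 x (hTS hx)
  exact ⟨C, ⟨mem_filter.2 ⟨hC, hT C hC x hxC hx⟩, hxC⟩,
    fun D hD => hu D ⟨(mem_filter.1 hD.1).1, hD.2⟩⟩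

/-- Let `ρ ∈ NC(k)` and let `B` be the block of `ρ` containing `1`,
dividing `{1,…,k}` into maximal segments disjoint from `B`.  Then:
(a) for each such segment `T`, the restriction `ρ|_T` (the blocks of `ρ` contained in
`T`) is an inner partition of `ρ`;
(b) every inner partition of `ρ|_T` (as a partition of `T`) is an inner partition of `ρ`;
(c) conversely, every inner partition of `ρ` equals some `ρ|_T` or is an inner
partition of some `ρ|_T`. -/
theorem statement3 (k : ℕ) (hk : 1 ≤ k) (ρ : Finset (Finset ℕ))
    (hρ : IsNCPartitionOn (Finset.Icc 1 k) ρ)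
    (B : Finset ℕ) (hB : B ∈ ρ) (h1 : 1 ∈ B) :
    (∀ T : Finset ℕ, IsGapSegment (Finset.Icc 1 k) B T →
        IsInner (Finset.Icc 1 k) ρ (ρ.filter (· ⊆ T))) ∧
    (∀ T : Finset ℕ, IsGapSegment (Finset.Icc 1 k) B T →
        ∀ σ : Finset (Finset ℕ), IsInner T (ρ.filter (· ⊆ T)) σ →
          IsInner (Finset.Icc 1 k) ρ σ) ∧
    (∀ σ : Finset (Finset ℕ), IsInner (Finset.Icc 1 k) ρ σ →
        ∃ T : Finset ℕ, IsGapSegment (Finset.Icc 1 k) B T ∧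
          (σ = ρ.filter (· ⊆ T) ∨ IsInner T (ρ.filter (· ⊆ T)) σ)) := by
  have hblock : ∀ {p q}, p ∈ B → (q = k ∨ q + 1 ∈ B) → (∀ x ∈ B, ¬ (p < x ∧ x ≤ q)) →
      ∀ C ∈ ρ, ∀ x ∈ C, x ∈ Icc (p + 1) q → C ⊆ Icc (p + 1) q := by
    intro p q hpB hq hgap C hC x hx hxT
    rw [mem_Icc] at hxT
    exact hρ.subset_segment hB h1 hpB hq hgap hC hx (by omega) hxT.2
  have hres : ∀ {p q}, p ∈ B → q ≤ k → (q = k ∨ q + 1 ∈ B) →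
      (∀ x ∈ B, ¬ (p < x ∧ x ≤ q)) →
      IsNCPartitionOn (Icc (p + 1) q) (ρ.filter (· ⊆ Icc (p + 1) q)) := by
    intro p q hpB hqk hq hgap
    exact hρ.filter_subset (Icc_subset_Icc (by omega) hqk) (hblock hpB hq hgap)
  have hBsub : ∀ {p q : ℕ}, 1 ≤ p → ¬ B ⊆ Icc (p + 1) q := by
    intro p q hp h
    have := mem_Icc.1 (h h1)
    omega
  refine ⟨fun T hT => ?_, fun T hT σ hσ => ?_, fun σ hσ => ?_⟩
  · obtain ⟨p, q, hpq, hqk, rfl, hp1, hpB, hq, hgap⟩ := (isGapSegment_iff h1).1 hT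
    have hBout : B ∈ ρ \ ρ.filter (· ⊆ Icc (p + 1) q) := by
      simp [hB, hBsub hp1]
    have hr := hres hpB hqk hq hgap
    have hmem : ∀ x, (∃ C ∈ ρ.filter (· ⊆ Icc (p + 1) q), x ∈ C) ↔
        x ∈ Icc 1 k ∧ p + 1 ≤ x ∧ x ≤ q := by
      intro x
      constructor
      · rintro ⟨C, hC, hx⟩
        have := mem_Icc.1 ((mem_filter.1 hC).2 hx)
        rw [mem_Icc]
        omega
      · rintro ⟨-, hx⟩
        exact (hr.1.2.2 x (mem_Icc.2 hx)).exists
    obtain ⟨C, hC, -⟩ := (hmem q).2 (by rw [mem_Icc]; omega)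
    refine (isInner_iff hρ).2 ⟨Finset.filter_subset _ _, ⟨B, hBout⟩, ⟨C, hC⟩,
      p + 1, mem_Icc.2 (by omega), q, mem_Icc.2 (by omega), by omega, hmem,
      p, mem_Icc.2 (by omega), by omega, fun b _ _ => by omega, fun b hb hqb => ?_⟩
    have hbk := mem_Icc.1 hb
    have hq' : q + 1 ∈ B := hq.resolve_left (by omega)
    exact ⟨B, hBout, q + 1, hq', p, hpB, by omega, by omega, .inl le_rfl⟩
  · obtain ⟨p, q, hpq, hqk, rfl, hp1, hpB, hq, hgap⟩ := (isGapSegment_iff h1).1 hT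
    obtain ⟨hsub, -, hin, i, hi, j, hj, hij, hmem, a, ha, hai, hmax, hsep⟩ :=
      (isInner_iff (hres hpB hqk hq hgap)).1 hσ
    rw [mem_Icc] at hi hj ha
    have hBout : B ∈ ρ \ σ :=
      mem_sdiff.2 ⟨hB, fun h => hBsub hp1 (mem_filter.1 (hsub h)).2⟩
    refine (isInner_iff hρ).2 ⟨hsub.trans (Finset.filter_subset _ _), ⟨B, hBout⟩, hin,
      i, mem_Icc.2 (by omega), j, mem_Icc.2 (by omega), hij, fun x => ?_,
      a, mem_Icc.2 (by omega), hai, fun b hb hbi => ?_, fun b hb hjb => ?_⟩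
    · rw [hmem, mem_Icc, mem_Icc]
      omega
    · by_contra! hab
      have := hmax b (mem_Icc.2 (by omega)) hbi
      omega
    · rcases Nat.lt_or_ge q b with hqb | hbq
      · have hbk := mem_Icc.1 hb
        have hq' : q + 1 ∈ B := hq.resolve_left (by omega)
        exact ⟨B, hBout, q + 1, hq', p, hpB, by omega, by omega, .inl (by omega)⟩
      · obtain ⟨C, hC, hs⟩ := hsep b (mem_Icc.2 (by omega)) hjb
        obtain ⟨hC, hCσ⟩ := mem_sdiff.1 hC
        exact ⟨C, mem_sdiff.2 ⟨(mem_filter.1 hC).1, hCσ⟩, hs⟩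
  · obtain ⟨hsub, -, hin, i, hi, j, hj, hij, hmem, a, ha, hai, hmax, hsep⟩ :=
      (isInner_iff hρ).1 hσ
    rw [mem_Icc] at hi hj ha
    have hai' : a + 1 = i := by
      have := hmax (i - 1) (mem_Icc.2 (by omega)) (by omega)
      omega
    have hBσ : B ∉ σ := fun h => by
      have := (hmem 1).1 ⟨B, h, h1⟩
      omega
    have hcover : ∀ C ∈ ρ, ∀ x ∈ C, i ≤ x → x ≤ j → C ∈ σ := by
      intro C hC x hx hix hxj
      have hxS := hρ.1.2.1 C hC hx
      obtain ⟨D, hD, hxD⟩ := (hmem x).2 ⟨hxS, hix, hxj⟩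
      rwa [(hρ.1.2.2 x hxS).unique ⟨hC, hx⟩ ⟨hsub hD, hxD⟩]
    obtain ⟨p, q, hpi, hjq, hqk, hp1, hpB, hq, hgap⟩ :=
      exists_isGapSegment (hρ.1.2.1 B hB) h1 (by omega) hij hj.2
        fun x hx hxij => hBσ (hcover B hB x hx hxij.1 hxij.2)
    have hσT : σ ⊆ ρ.filter (· ⊆ Icc (p + 1) q) := by
      refine fun C hC => mem_filter.2 ⟨hsub hC, fun x hx => ?_⟩
      have := (hmem x).1 ⟨C, hC, hx⟩
      rw [mem_Icc]
      omega
    refine ⟨Icc (p + 1) q,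
      (isGapSegment_iff h1).2 ⟨p, q, by omega, hqk, rfl, hp1, hpB, hq, hgap⟩, ?_⟩
    have hsep' : ∀ b, j < b → b ≤ q →
        ∃ C ∈ ρ.filter (· ⊆ Icc (p + 1) q) \ σ, Separates C a b := by
      intro b hjb hbq
      obtain ⟨C, hC, x, hx, y, hy, hs⟩ := hsep b (mem_Icc.2 (by omega)) hjb
      obtain ⟨hC, hCσ⟩ := mem_sdiff.1 hC
      exact ⟨C, mem_sdiff.2 ⟨mem_filter.2 ⟨hC,
        hblock hpB hq hgap C hC x hx (mem_Icc.2 (by omega))⟩, hCσ⟩, x, hx, y, hy, hs⟩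
    rcases Nat.lt_or_ge p a with hpa | hap
    · right
      have hr := hres hpB hqk hq hgap
      obtain ⟨A, ⟨hA, haA⟩, -⟩ := hr.1.2.2 a (mem_Icc.2 (by omega))
      have hAσ : A ∉ σ := fun h => by
        have := (hmem a).1 ⟨A, h, haA⟩
        omega
      refine (isInner_iff hr).2 ⟨hσT, ⟨A, mem_sdiff.2 ⟨hA, hAσ⟩⟩, hin,
        i, mem_Icc.2 (by omega), j, mem_Icc.2 (by omega), hij, fun x => ?_,
        a, mem_Icc.2 (by omega), hai, fun b _ _ => by omega,
        fun b hb hjb => hsep' b hjb (mem_Icc.1 hb).2⟩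
      rw [hmem, mem_Icc, mem_Icc]
      omega
    · left
      have hjq' : j = q := by
        by_contra hne
        obtain ⟨C, hC, x, hx, y, hy, hs⟩ := hsep' q (by omega) le_rfl
        have := mem_Icc.1 ((mem_filter.1 (mem_sdiff.1 hC).1).2 hy)
        omega
      refine Subset.antisymm hσT fun C hC => ?_
      obtain ⟨hC, hCT⟩ := mem_filter.1 hC
      obtain ⟨x, hx⟩ := hρ.1.1 C hC
      have := mem_Icc.1 (hCT hx)
      exact hcover C hC x hx (by omega) (by omega)
end
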